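/- Let E = (E⁰, E¹, r, s) be a directed graph, K a field, H ⊆ E⁰ a saturated hereditary subset, and S ⊆ B_H. Let I_{(H,S)} be the two-sided ideal of L_K(E) generated by {v : v ∈ H} ∪ {v^H : v ∈ S}. Then there exists an injective K-algebra homomorphism φ : L_K(\overline{E}_{(H,S)}) → L_K(E) whose image is exactly I_{(H,S)}; consequently, the ideal I_{(H,S)}, viewed as a (not necessarily unital) K-algebra, is isomorphic to the Leavitt path algebra L_K(\overline{E}_{(H,S)}). -/

import Mathlib

namespace GraphIdeals

variable {V E : Type*}

def pathRel (r s : E → V) : E → E → Prop := fun e f => r e = s f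
def Hereditary (r s : E → V) (H : Set V) : Prop := ∀ e : E, s e ∈ H → r e ∈ H
def Regular (s : E → V) (v : V) : Prop := (s ⁻¹' {v}).Finite ∧ (s ⁻¹' {v}).Nonempty
def Saturated (r s : E → V) (H : Set V) : Prop :=
  ∀ v : V, Regular s v → (∀ e : E, s e = v → r e ∈ H) → v ∈ H
def breakingVertices (r s : E → V) (H : Set V) : Set V :=
  {v | (s ⁻¹' {v}).Infinite ∧ {e : E | s e = v ∧ r e ∉ H}.Finite ∧
      {e : E | s e = v ∧ r e ∉ H}.Nonempty}

section LPA

variable (K : Type*) [Field K]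

/-- Generators of the Leavitt path algebra: a vertex `v`, a real edge `e`,
or a ghost edge `e*`. -/
abbrev LGen (V E : Type*) : Type _ := V ⊕ E ⊕ E

/-- The defining relations of the Leavitt path algebra of the graph
`(V, E, r, s)` with coefficients in `K`, imposed on the free associative
`K`-algebra on the generators `LGen V E`. -/
inductive LRel (r s : E → V) :
    FreeAlgebra K (LGen V E) → FreeAlgebra K (LGen V E) → Prop
  | vertOrth {v w : V} (h : v ≠ w) :
      LRel r s (FreeAlgebra.ι K (Sum.inl v : LGen V E) *
        FreeAlgebra.ι K (Sum.inl w : LGen V E)) 0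
  | vertIdem (v : V) :
      LRel r s (FreeAlgebra.ι K (Sum.inl v : LGen V E) *
        FreeAlgebra.ι K (Sum.inl v : LGen V E))
        (FreeAlgebra.ι K (Sum.inl v : LGen V E))
  | srcMul (e : E) :
      LRel r s (FreeAlgebra.ι K (Sum.inl (s e) : LGen V E) *
        FreeAlgebra.ι K (Sum.inr (Sum.inl e) : LGen V E))
        (FreeAlgebra.ι K (Sum.inr (Sum.inl e) : LGen V E))
  | mulRng (e : E) :
      LRel r s (FreeAlgebra.ι K (Sum.inr (Sum.inl e) : LGen V E) *
        FreeAlgebra.ι K (Sum.inl (r e) : LGen V E))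
        (FreeAlgebra.ι K (Sum.inr (Sum.inl e) : LGen V E))
  | rngMulStar (e : E) :
      LRel r s (FreeAlgebra.ι K (Sum.inl (r e) : LGen V E) *
        FreeAlgebra.ι K (Sum.inr (Sum.inr e) : LGen V E))
        (FreeAlgebra.ι K (Sum.inr (Sum.inr e) : LGen V E))
  | starMulSrc (e : E) :
      LRel r s (FreeAlgebra.ι K (Sum.inr (Sum.inr e) : LGen V E) *
        FreeAlgebra.ι K (Sum.inl (s e) : LGen V E))
        (FreeAlgebra.ι K (Sum.inr (Sum.inr e) : LGen V E))
  | ck1Orth {e f : E} (h : e ≠ f) :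
      LRel r s (FreeAlgebra.ι K (Sum.inr (Sum.inr e) : LGen V E) *
        FreeAlgebra.ι K (Sum.inr (Sum.inl f) : LGen V E)) 0
  | ck1 (e : E) :
      LRel r s (FreeAlgebra.ι K (Sum.inr (Sum.inr e) : LGen V E) *
        FreeAlgebra.ι K (Sum.inr (Sum.inl e) : LGen V E))
        (FreeAlgebra.ι K (Sum.inl (r e) : LGen V E))
  | ck2 (v : V) (hfin : (s ⁻¹' {v}).Finite) (hne : (s ⁻¹' {v}).Nonempty) :
      LRel r s (FreeAlgebra.ι K (Sum.inl v : LGen V E))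
        (∑ e ∈ hfin.toFinset,
          FreeAlgebra.ι K (Sum.inr (Sum.inl e) : LGen V E) *
          FreeAlgebra.ι K (Sum.inr (Sum.inr e) : LGen V E))

/-- The (unitalized) Leavitt path algebra: the quotient of the free associative
`K`-algebra on the generators by the Leavitt relations.  The Leavitt path algebra
proper is the non-unital subalgebra generated by the images of the generators; see
`LPAvert`, `LPAedge`, `LPAghost`. -/
abbrev LPA (r s : E → V) : Type _ := RingQuot (LRel K r s)

/-- The vertex idempotent `v` in the Leavitt path algebra. -/
def vert (r s : E → V) (v : V) : LPA K r s :=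
  RingQuot.mkAlgHom K (LRel K r s) (FreeAlgebra.ι K (Sum.inl v : LGen V E))

/-- The real edge `e` in the Leavitt path algebra. -/
def edge (r s : E → V) (e : E) : LPA K r s :=
  RingQuot.mkAlgHom K (LRel K r s) (FreeAlgebra.ι K (Sum.inr (Sum.inl e) : LGen V E))

/-- The ghost edge `e*` in the Leavitt path algebra. -/
def ghost (r s : E → V) (e : E) : LPA K r s :=
  RingQuot.mkAlgHom K (LRel K r s) (FreeAlgebra.ι K (Sum.inr (Sum.inr e) : LGen V E))

/-- `RangedPath r s p v` : `p` is a path (possibly of length `0`) with range `v`;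
a path of length `0` is a vertex. -/
def RangedPath (r s : E → V) (p : List E) (v : V) : Prop :=
  p.Chain' (pathRel r s) ∧ ∀ h : p ≠ [], r (p.getLast h) = v

/-- The monomial `α` in the Leavitt path algebra associated to a path `α` with
range `v`: the product of the edges of `α`, or the idempotent `v` if `α` has
length `0`. -/
def pathE (r s : E → V) (p : List E) (v : V) : LPA K r s :=
  if p.isEmpty then vert K r s v else (p.map (edge K r s)).prod

/-- The monomial `α*` in the Leavitt path algebra associated to a path `α` with
range `v`: the product of the ghost edges of `α` in reverse order, or the
idempotent `v` if `α` has length `0`. -/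
def pathStarE (r s : E → V) (p : List E) (v : V) : LPA K r s :=
  if p.isEmpty then vert K r s v else (p.reverse.map (ghost K r s)).prod

/-- The gap idempotent `v^H = v − ∑_{s(e) = v, r(e) ∉ H} e e*`. -/
noncomputable def gapL (r s : E → V) (H : Set V) (v : V)
    (hfin : {e : E | s e = v ∧ r e ∉ H}.Finite) : LPA K r s :=
  vert K r s v - ∑ e ∈ hfin.toFinset, edge K r s e * ghost K r s e

/-- The generating set `{v : v ∈ H} ∪ {v^H : v ∈ S}` of the ideal `I_{(H,S)}`. -/
def idealGens (r s : E → V) (H S : Set V) (hS : S ⊆ breakingVertices r s H) :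
    Set (LPA K r s) :=
  (vert K r s '' H) ∪
    {x | ∃ v : V, ∃ hv : v ∈ S, x = gapL K r s H v ((hS hv).2.1)}

end LPA

section Bar

/-- `F₁(H,S)`: paths `e₁ ⋯ eₙ` of length `≥ 1` with `r(eₙ) ∈ H` and `s(eₙ) ∉ H ∪ S`. -/
def F1 (r s : E → V) (H S : Set V) : Set (List E) :=
  {p | ∃ h : p ≠ [], p.Chain' (pathRel r s) ∧
        r (p.getLast h) ∈ H ∧ s (p.getLast h) ∉ H ∪ S}

/-- `F₂(H,S)`: paths of length `≥ 1` with range in `S`. -/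
def F2 (r s : E → V) (H S : Set V) : Set (List E) :=
  {p | ∃ h : p ≠ [], p.Chain' (pathRel r s) ∧ r (p.getLast h) ∈ S}

/-- Vertices of the graph `Ē_{(H,S)}`. -/
abbrev BarV (r s : E → V) (H S : Set V) : Type _ :=
  ({v : V // v ∈ H} ⊕ {v : V // v ∈ S}) ⊕
    ({p : List E // p ∈ F1 r s H S} ⊕ {p : List E // p ∈ F2 r s H S})

/-- Edges of the graph `Ē_{(H,S)}`. -/
abbrev BarE (r s : E → V) (H S : Set V) : Type _ :=
  ({e : E // s e ∈ H} ⊕ {e : E // s e ∈ S ∧ r e ∈ H}) ⊕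
    ({p : List E // p ∈ F1 r s H S} ⊕ {p : List E // p ∈ F2 r s H S})

/-- The source map of `Ē_{(H,S)}`. -/
def barS (r s : E → V) (H S : Set V) : BarE r s H S → BarV r s H S
  | .inl (.inl e) => .inl (.inl ⟨s e.1, e.2⟩)
  | .inl (.inr e) => .inl (.inr ⟨s e.1, e.2.1⟩)
  | .inr (.inl p) => .inr (.inl p)
  | .inr (.inr p) => .inr (.inr p)

/-- The range map of `Ē_{(H,S)}` (well defined since `H` is hereditary). -/
def barR (r s : E → V) (H S : Set V) (hH : Hereditary r s H) :
    BarE r s H S → BarV r s H S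
  | .inl (.inl e) => .inl (.inl ⟨r e.1, hH e.1 e.2⟩)
  | .inl (.inr e) => .inl (.inl ⟨r e.1, e.2.2⟩)
  | .inr (.inl p) => .inl (.inl ⟨r (p.1.getLast p.2.choose), p.2.choose_spec.2.1⟩)
  | .inr (.inr p) => .inl (.inr ⟨r (p.1.getLast p.2.choose), p.2.choose_spec.2⟩)

variable (K : Type*) [Field K]

/-- The Leavitt path algebra proper of the graph `(V, E, r, s)`: the non-unital
`K`-subalgebra of the quotient `LPA K r s` of the free algebra generated by the
vertices, real edges and ghost edges.  (For a graph with infinitely many vertices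
the ambient quotient is the unitization of this algebra.) -/
def LPAproper (r s : E → V) : NonUnitalSubalgebra K (LPA K r s) :=
  NonUnitalAlgebra.adjoin K
    (Set.range (vert K r s) ∪ Set.range (edge K r s) ∪ Set.range (ghost K r s))

section Family

/-- A Leavitt family of the graph `(V, E, r, s)` in a ring: elements satisfying the defining
relations of the Leavitt path algebra. -/
structure LeavittFamily {V E : Type*} (r s : E → V) (A : Type*) [Ring A] where
  P : V → A
  T : E → A
  U : E → A
  vertOrth : ∀ {v w : V}, v ≠ w → P v * P w = 0
  vertIdem : ∀ v, P v * P v = P v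
  srcMul : ∀ e, P (s e) * T e = T e
  mulRng : ∀ e, T e * P (r e) = T e
  rngMulStar : ∀ e, P (r e) * U e = U e
  starMulSrc : ∀ e, U e * P (s e) = U e
  ck1Orth : ∀ {e f : E}, e ≠ f → U e * T f = 0
  ck1 : ∀ e, U e * T e = P (r e)
  ck2 : ∀ (v : V) (hfin : (s ⁻¹' {v}).Finite), (s ⁻¹' {v}).Nonempty →
    P v = ∑ e ∈ hfin.toFinset, T e * U e

namespace LeavittFamily

section Lift

variable {K} {r s : E → V} {A : Type*} [Ring A] [Algebra K A]

/-- The algebra homomorphism out of the Leavitt path algebra induced by a Leavitt family. -/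
noncomputable def lift (F : LeavittFamily r s A) : LPA K r s →ₐ[K] A :=
  RingQuot.liftAlgHom K ⟨FreeAlgebra.lift K (Sum.elim F.P (Sum.elim F.T F.U)), by
    rintro _ _ (h | v | e | e | e | e | h | e | ⟨v, hfin, hne⟩)
    · simpa using F.vertOrth h
    · simpa using F.vertIdem v
    · simpa using F.srcMul e
    · simpa using F.mulRng e
    · simpa using F.rngMulStar e
    · simpa using F.starMulSrc e
    · simpa using F.ck1Orth h
    · simpa using F.ck1 e
    · simpa using F.ck2 v hfin hne⟩

@[simp]
theorem lift_vert (F : LeavittFamily r s A) (v : V) : F.lift (vert K r s v) = F.P v := by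
  simp [lift, vert]

@[simp]
theorem lift_edge (F : LeavittFamily r s A) (e : E) : F.lift (edge K r s e) = F.T e := by
  simp [lift, edge]

@[simp]
theorem lift_ghost (F : LeavittFamily r s A) (e : E) : F.lift (ghost K r s e) = F.U e := by
  simp [lift, ghost]

end Lift

/-- The tautological Leavitt family in the Leavitt path algebra. -/
def univ (r s : E → V) : LeavittFamily r s (LPA K r s) where
  P := vert K r s
  T := edge K r s
  U := ghost K r s
  vertOrth h := by
    simpa [vert] using RingQuot.mkAlgHom_rel K (LRel.vertOrth (K := K) (r := r) (s := s) h)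
  vertIdem v := by
    simpa [vert] using RingQuot.mkAlgHom_rel K (LRel.vertIdem (K := K) (r := r) (s := s) v)
  srcMul e := by
    simpa [vert, edge] using RingQuot.mkAlgHom_rel K (LRel.srcMul (K := K) (r := r) (s := s) e)
  mulRng e := by
    simpa [vert, edge] using RingQuot.mkAlgHom_rel K (LRel.mulRng (K := K) (r := r) (s := s) e)
  rngMulStar e := by
    simpa [vert, ghost] using
      RingQuot.mkAlgHom_rel K (LRel.rngMulStar (K := K) (r := r) (s := s) e)
  starMulSrc e := by
    simpa [vert, ghost] using
      RingQuot.mkAlgHom_rel K (LRel.starMulSrc (K := K) (r := r) (s := s) e)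
  ck1Orth h := by
    simpa [ghost, edge] using RingQuot.mkAlgHom_rel K (LRel.ck1Orth (K := K) (r := r) (s := s) h)
  ck1 e := by
    simpa [vert, ghost, edge] using
      RingQuot.mkAlgHom_rel K (LRel.ck1 (K := K) (r := r) (s := s) e)
  ck2 v hfin hne := by
    simpa [vert, ghost, edge] using
      RingQuot.mkAlgHom_rel K (LRel.ck2 (K := K) (r := r) (s := s) v hfin hne)

/-- Induction principle for the Leavitt path algebra. -/
theorem lpa_induction {r s : E → V} {p : LPA K r s → Prop}
    (algebraMap : ∀ k, p (algebraMap K _ k)) (vert : ∀ v, p (vert K r s v))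
    (edge : ∀ e, p (edge K r s e)) (ghost : ∀ e, p (ghost K r s e))
    (mul : ∀ a b, p a → p b → p (a * b)) (add : ∀ a b, p a → p b → p (a + b))
    (x : LPA K r s) : p x := by
  obtain ⟨y, rfl⟩ := RingQuot.mkAlgHom_surjective K (LRel K r s) x
  induction y using FreeAlgebra.induction with
  | grade0 k => simpa using algebraMap k
  | grade1 g =>
    rcases g with v | e | e
    · exact vert v
    · exact edge e
    · exact ghost e
  | mul a b ha hb => simpa using mul _ _ ha hb
  | add a b ha hb => simpa using add _ _ ha hb

end LeavittFamily

end Family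

section Path

variable (r s : E → V) (H Z : Set V)

/-- The source of a path with range `u`, the empty path being the vertex `u`. -/
def pathSrc (s : E → V) : List E → V → V
  | [], u => u
  | e :: _, _ => s e

/-- The paths with range in `Z` whose last edge, if there is one, does not go from `Z` to `H`. -/
def ValidPath : List E → V → Prop
  | [], u => u ∈ Z
  | e :: q, u => r e = pathSrc s q u ∧ ValidPath q u ∧ (q = [] → u ∈ H → s e ∉ Z)

variable {r s H Z}

theorem ValidPath.mem : ∀ {p : List E} {u : V}, ValidPath r s H Z p u → u ∈ Z
  | [], _, h => h
  | _ :: _, _, h => h.2.1.mem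

theorem ValidPath.eq_nil (hH : Hereditary r s H) (hHZ : H ⊆ Z) :
    ∀ {p : List E} {u : V}, ValidPath r s H Z p u → pathSrc s p u ∈ H → p = []
  | [], _, _, _ => rfl
  | e :: q, u, h, he => by
    have h1 : r e ∈ H := hH e he
    rw [h.1] at h1
    obtain rfl := h.2.1.eq_nil hH hHZ h1
    exact absurd (hHZ he) (h.2.2 rfl h1)

theorem ValidPath.not_core (hH : Hereditary r s H) (hHZ : H ⊆ Z) {e : E} {q : List E} {u : V}
    (h : ValidPath r s H Z (e :: q) u) : ¬ (s e ∈ Z ∧ r e ∈ H) := by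
  rintro ⟨hs, hr⟩
  rw [h.1] at hr
  obtain rfl := h.2.1.eq_nil hH hHZ hr
  exact h.2.2 rfl hr hs

theorem validPath_iff {p : List E} (hp : p ≠ []) {u : V} :
    ValidPath r s H Z p u ↔ p.IsChain (pathRel r s) ∧ r (p.getLast hp) = u ∧ u ∈ Z ∧
      (u ∈ H → s (p.getLast hp) ∉ Z) := by
  induction p with
  | nil => exact absurd rfl hp
  | cons e q ih =>
    rcases q with _ | ⟨f, q⟩
    · simp [ValidPath, pathSrc]
    · have := ih (by simp)
      rw [ValidPath, this]
      simp [pathSrc, pathRel, and_assoc]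

end Path

namespace LeavittFamily

variable {r s : E → V} {H Z : Set V} {A : Type*} [Ring A] (F : LeavittFamily r s A)

open scoped Classical in
/-- The edges leaving `v` with range outside `H` (provided they are finitely many). -/
noncomputable def outEdges (r s : E → V) (H : Set V) (v : V) : Finset E :=
  if h : {e : E | s e = v ∧ r e ∉ H}.Finite then h.toFinset else ∅

theorem mem_outEdges {v : V} (h : {e : E | s e = v ∧ r e ∉ H}.Finite) {e : E} :
    e ∈ outEdges r s H v ↔ s e = v ∧ r e ∉ H := by
  simp [outEdges, h]

theorem of_mem_outEdges {v : V} {e : E} (h : e ∈ outEdges r s H v) : s e = v ∧ r e ∉ H := by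
  rw [outEdges] at h
  split_ifs at h with hf
  · simpa using h
  · simp at h

/-- The gap idempotent of a Leavitt family. -/
noncomputable def gap (H : Set V) (v : V) : A :=
  F.P v - ∑ e ∈ outEdges r s H v, F.T e * F.U e

/-- The monomial `α g(u)`, where `α` is a path with range `u` and `g(u)` is the gap idempotent. -/
noncomputable def mon (H : Set V) : List E → V → A
  | [], u => F.gap H u
  | e :: q, u => F.T e * mon H q u

/-- The monomial `g(u) α*`, where `α` is a path with range `u` and `g(u)` is the gap idempotent. -/
noncomputable def monStar (H : Set V) : List E → V → A
  | [], u => F.gap H u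
  | e :: q, u => monStar H q u * F.U e

theorem P_mul_T_of_ne {v : V} {e : E} (h : s e ≠ v) : F.P v * F.T e = 0 := by
  rw [← F.srcMul, ← mul_assoc, F.vertOrth h.symm, zero_mul]

theorem U_mul_P_of_ne {v : V} {e : E} (h : s e ≠ v) : F.U e * F.P v = 0 := by
  rw [← F.starMulSrc, mul_assoc, F.vertOrth h, mul_zero]

theorem gap_eq_P {v : V} (hH : Hereditary r s H) (hv : v ∈ H) : F.gap H v = F.P v := by
  rw [gap, Finset.sum_eq_zero, sub_zero]
  intro e he
  obtain ⟨rfl, h⟩ := of_mem_outEdges he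
  exact absurd (hH e hv) h

theorem P_mul_gap (v : V) : F.P v * F.gap H v = F.gap H v := by
  rw [gap, mul_sub, F.vertIdem, Finset.mul_sum]
  congr 1
  refine Finset.sum_congr rfl fun e he => ?_
  rw [← (of_mem_outEdges he).1, ← mul_assoc, F.srcMul]

theorem gap_mul_P (v : V) : F.gap H v * F.P v = F.gap H v := by
  rw [gap, sub_mul, F.vertIdem, Finset.sum_mul]
  congr 1
  refine Finset.sum_congr rfl fun e he => ?_
  rw [← (of_mem_outEdges he).1, mul_assoc, F.starMulSrc]

theorem P_mul_gap_of_ne {v w : V} (h : v ≠ w) : F.P v * F.gap H w = 0 := by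
  rw [← P_mul_gap, ← mul_assoc, F.vertOrth h, zero_mul]

theorem gap_mul_T_of_ne {v : V} {e : E} (h : s e ≠ v) : F.gap H v * F.T e = 0 := by
  rw [← gap_mul_P, mul_assoc, F.P_mul_T_of_ne h, mul_zero]

theorem U_mul_gap_of_ne {v : V} {e : E} (h : s e ≠ v) : F.U e * F.gap H v = 0 := by
  rw [← P_mul_gap, ← mul_assoc, F.U_mul_P_of_ne h, zero_mul]

theorem gap_mul_T {e : E} (h : r e ∈ H) : F.gap H (s e) * F.T e = F.T e := by
  rw [gap, sub_mul, F.srcMul, Finset.sum_mul, Finset.sum_eq_zero, sub_zero]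
  intro f hf
  rw [mul_assoc, F.ck1Orth, mul_zero]
  rintro rfl
  exact (of_mem_outEdges hf).2 h

theorem U_mul_gap {e : E} (h : r e ∈ H) : F.U e * F.gap H (s e) = F.U e := by
  rw [gap, mul_sub, F.starMulSrc, Finset.mul_sum, Finset.sum_eq_zero, sub_zero]
  intro f hf
  rw [← mul_assoc, F.ck1Orth, zero_mul]
  rintro rfl
  exact (of_mem_outEdges hf).2 h

theorem gap_mul_T_of_notMem {e : E} (hf : {f : E | s f = s e ∧ r f ∉ H}.Finite) (h : r e ∉ H) :
    F.gap H (s e) * F.T e = 0 := by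
  rw [gap, sub_mul, F.srcMul, Finset.sum_mul, Finset.sum_eq_single e, mul_assoc, F.ck1, F.mulRng,
    sub_self]
  · intro f _ hfe
    rw [mul_assoc, F.ck1Orth hfe, mul_zero]
  · exact fun he => absurd ((mem_outEdges hf).2 ⟨rfl, h⟩) he

theorem U_mul_gap_of_notMem {e : E} (hf : {f : E | s f = s e ∧ r f ∉ H}.Finite) (h : r e ∉ H) :
    F.U e * F.gap H (s e) = 0 := by
  rw [gap, mul_sub, F.starMulSrc, Finset.mul_sum, Finset.sum_eq_single e, ← mul_assoc, F.ck1,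
    F.rngMulStar, sub_self]
  · intro f _ hfe
    rw [← mul_assoc, F.ck1Orth hfe.symm, zero_mul]
  · exact fun he => absurd ((mem_outEdges hf).2 ⟨rfl, h⟩) he

theorem gap_mul_gap {v : V} (hf : {f : E | s f = v ∧ r f ∉ H}.Finite) :
    F.gap H v * F.gap H v = F.gap H v := by
  change F.gap H v * (F.P v - ∑ e ∈ outEdges r s H v, F.T e * F.U e) = _
  rw [mul_sub, gap_mul_P, Finset.mul_sum, Finset.sum_eq_zero, sub_zero]
  intro e he
  obtain ⟨rfl, h⟩ := of_mem_outEdges he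
  rw [← mul_assoc, F.gap_mul_T_of_notMem hf h, zero_mul]

theorem gap_mul_gap_of_ne {v w : V} (h : v ≠ w) : F.gap H v * F.gap H w = 0 := by
  rw [← gap_mul_P, mul_assoc, F.P_mul_gap_of_ne h, mul_zero]

theorem P_mul_mon (p : List E) (u : V) : F.P (pathSrc s p u) * F.mon H p u = F.mon H p u := by
  cases p with
  | nil => exact F.P_mul_gap u
  | cons e q => rw [mon, ← mul_assoc, pathSrc, F.srcMul]

theorem monStar_mul_P (p : List E) (u : V) :
    F.monStar H p u * F.P (pathSrc s p u) = F.monStar H p u := by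
  cases p with
  | nil => exact F.gap_mul_P u
  | cons e q => rw [monStar, mul_assoc, pathSrc, F.starMulSrc]

theorem P_mul_mon_of_ne {v : V} {p : List E} {u : V} (h : v ≠ pathSrc s p u) :
    F.P v * F.mon H p u = 0 := by
  rw [← P_mul_mon, ← mul_assoc, F.vertOrth h, zero_mul]

theorem monStar_mul_P_of_ne {v : V} {p : List E} {u : V} (h : v ≠ pathSrc s p u) :
    F.monStar H p u * F.P v = 0 := by
  rw [← monStar_mul_P, mul_assoc, F.vertOrth h.symm, mul_zero]

section Valid

variable (hH : Hereditary r s H) (hHZ : H ⊆ Z)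
  (hfin : ∀ v ∈ Z, {f : E | s f = v ∧ r f ∉ H}.Finite)

include hfin in
theorem mon_mul_gap {p : List E} {u : V} (h : u ∈ Z) :
    F.mon H p u * F.gap H u = F.mon H p u := by
  induction p with
  | nil => exact F.gap_mul_gap (hfin u h)
  | cons e q ih => rw [mon, mul_assoc, ih]

include hfin in
theorem gap_mul_monStar {p : List E} {u : V} (h : u ∈ Z) :
    F.gap H u * F.monStar H p u = F.monStar H p u := by
  induction p with
  | nil => exact F.gap_mul_gap (hfin u h)
  | cons e q ih => rw [monStar, ← mul_assoc, ih]

include hfin in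
theorem monStar_mul_mon {p : List E} {u : V} (h : ValidPath r s H Z p u) :
    F.monStar H p u * F.mon H p u = F.gap H u := by
  induction p with
  | nil => exact F.gap_mul_gap (hfin u h)
  | cons e q ih =>
    rw [monStar, mon, mul_assoc, ← mul_assoc (F.U e), F.ck1, h.1, P_mul_mon, ih h.2.1]

include hH hHZ hfin

theorem gap_mul_mon_cons {v : V} (hv : v ∈ Z) {e : E} {q : List E} {u : V}
    (h : ValidPath r s H Z (e :: q) u) : F.gap H v * F.mon H (e :: q) u = 0 := by
  rw [mon, ← mul_assoc]
  by_cases hs : s e = v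
  · subst hs
    rw [F.gap_mul_T_of_notMem (hfin _ hv) fun hr => h.not_core hH hHZ ⟨hv, hr⟩, zero_mul]
  · rw [F.gap_mul_T_of_ne hs, zero_mul]

theorem monStar_cons_mul_gap {v : V} (hv : v ∈ Z) {e : E} {q : List E} {u : V}
    (h : ValidPath r s H Z (e :: q) u) : F.monStar H (e :: q) u * F.gap H v = 0 := by
  rw [monStar, mul_assoc]
  by_cases hs : s e = v
  · subst hs
    rw [F.U_mul_gap_of_notMem (hfin _ hv) fun hr => h.not_core hH hHZ ⟨hv, hr⟩, mul_zero]
  · rw [F.U_mul_gap_of_ne hs, mul_zero]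

theorem monStar_mul_mon_of_ne {p q : List E} {u v : V} (hp : ValidPath r s H Z p u)
    (hq : ValidPath r s H Z q v) (hne : (p, u) ≠ (q, v)) :
    F.monStar H p u * F.mon H q v = 0 := by
  induction p generalizing q with
  | nil =>
    cases q with
    | nil => exact F.gap_mul_gap_of_ne fun h => hne (by rw [h])
    | cons f q => exact F.gap_mul_mon_cons hH hHZ hfin hp hq
  | cons e p ih =>
    cases q with
    | nil => exact F.monStar_cons_mul_gap hH hHZ hfin hq hp
    | cons f q =>
      rw [monStar, mon, mul_assoc, ← mul_assoc (F.U e)]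
      by_cases hef : e = f
      · subst hef
        rw [F.ck1, hq.1, P_mul_mon, ih hp.2.1 hq.2.1]
        intro h
        simp_all
      · rw [F.ck1Orth hef, zero_mul, mul_zero]

end Valid

end LeavittFamily

section Representation

/-- Elements of `R` indexed by the vertices in `Z` and by the edges from `Z` to `H`, extended by
zero and satisfying the Leavitt relations at the vertices of `H`. -/
structure CoreFamily {V E : Type*} (r s : E → V) (H Z : Set V) (R : Type*) [Ring R] where
  P : V → R
  T : E → R
  U : E → R
  P_of_notMem : ∀ {v}, v ∉ Z → P v = 0
  T_of_not : ∀ {e}, ¬ (s e ∈ Z ∧ r e ∈ H) → T e = 0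
  U_of_not : ∀ {e}, ¬ (s e ∈ Z ∧ r e ∈ H) → U e = 0
  vertIdem : ∀ v, P v * P v = P v
  srcMul : ∀ e, P (s e) * T e = T e
  mulRng : ∀ e, T e * P (r e) = T e
  rngMulStar : ∀ e, P (r e) * U e = U e
  starMulSrc : ∀ e, U e * P (s e) = U e
  ck1Orth : ∀ {e f : E}, e ≠ f → U e * T f = 0
  ck1 : ∀ e, s e ∈ Z → r e ∈ H → U e * T e = P (r e)
  ck2 : ∀ (v : V) (hfin : (s ⁻¹' {v}).Finite), (s ⁻¹' {v}).Nonempty → v ∈ H →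
    P v = ∑ e ∈ hfin.toFinset, T e * U e

namespace CoreFamily

variable {r s : E → V} {H Z : Set V} {R : Type*} [Ring R] [Algebra K R]
  (G : CoreFamily r s H Z R)

open scoped Classical

/-- The action of a vertex on vectors indexed by paths. -/
noncomputable def repP (v : V) : Module.End K (List E → V → R) where
  toFun f p u := if ValidPath r s H Z p u ∧ pathSrc s p u = v then G.P u * f p u else 0
  map_add' f g := by ext p u; simp only [Pi.add_apply, mul_add]; split_ifs <;> simp
  map_smul' k f := by ext p u; simp only [Pi.smul_apply, mul_smul_comm]; split_ifs <;> simp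

/-- The action of an edge on vectors indexed by paths. -/
noncomputable def repT (e : E) : Module.End K (List E → V → R) where
  toFun f p u := match p with
    | [] => if s e = u then G.T e * f [] (r e) else 0
    | e' :: q => if e' = e ∧ ValidPath r s H Z (e' :: q) u then G.P u * f q u else 0
  map_add' f g := by
    ext p u
    cases p <;> simp only [Pi.add_apply, mul_add] <;> split_ifs <;> simp
  map_smul' k f := by
    ext p u
    cases p <;> simp only [Pi.smul_apply, mul_smul_comm] <;> split_ifs <;> simp

/-- The action of a ghost edge on vectors indexed by paths. -/
noncomputable def repU (e : E) : Module.End K (List E → V → R) where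
  toFun f p u := (if ValidPath r s H Z (e :: p) u then G.P u * f (e :: p) u else 0) +
    if p = [] ∧ u = r e then G.U e * f [] (s e) else 0
  map_add' f g := by
    ext p u
    simp only [Pi.add_apply, mul_add]
    split_ifs <;> abel
  map_smul' k f := by
    ext p u
    simp only [Pi.smul_apply, mul_smul_comm]
    split_ifs <;> simp

theorem repP_apply (v : V) (f : List E → V → R) (p : List E) (u : V) : G.repP K v f p u =
    if ValidPath r s H Z p u ∧ pathSrc s p u = v then G.P u * f p u else 0 := rfl

theorem repT_nil (e : E) (f : List E → V → R) (u : V) :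
    G.repT K e f [] u = if s e = u then G.T e * f [] (r e) else 0 := rfl

theorem repT_cons (e e' : E) (f : List E → V → R) (q : List E) (u : V) :
    G.repT K e f (e' :: q) u =
      if e' = e ∧ ValidPath r s H Z (e' :: q) u then G.P u * f q u else 0 := rfl

theorem repU_apply (e : E) (f : List E → V → R) (p : List E) (u : V) : G.repU K e f p u =
    (if ValidPath r s H Z (e :: p) u then G.P u * f (e :: p) u else 0) +
      if p = [] ∧ u = r e then G.U e * f [] (s e) else 0 := rfl

theorem P_mul_P_mul (v : V) (x : R) : G.P v * (G.P v * x) = G.P v * x := by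
  rw [← mul_assoc, G.vertIdem]

theorem P_mul_T_mul (e : E) (x : R) : G.P (s e) * (G.T e * x) = G.T e * x := by
  rw [← mul_assoc, G.srcMul]

theorem T_mul_P_mul (e : E) (x : R) : G.T e * (G.P (r e) * x) = G.T e * x := by
  rw [← mul_assoc, G.mulRng]

theorem P_mul_U_mul (e : E) (x : R) : G.P (r e) * (G.U e * x) = G.U e * x := by
  rw [← mul_assoc, G.rngMulStar]

theorem U_mul_P_mul (e : E) (x : R) : G.U e * (G.P (s e) * x) = G.U e * x := by
  rw [← mul_assoc, G.starMulSrc]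

variable (hH : Hereditary r s H) (hHZ : H ⊆ Z)
  (hreg : ∀ v ∈ Z, (s ⁻¹' {v}).Finite → (s ⁻¹' {v}).Nonempty → v ∈ H)

/-- The representation of the Leavitt relations on vectors indexed by paths. -/
noncomputable def rep : LeavittFamily r s (Module.End K (List E → V → R)) where
  P := G.repP K
  T := G.repT K
  U := G.repU K
  vertOrth {v w} h := by
    ext f p u
    simp only [Module.End.mul_apply, repP_apply, LinearMap.zero_apply, Pi.zero_apply]
    split_ifs with h1 h2
    · exact absurd (h1.2.symm.trans h2.2) h
    · simp
    · rfl
  vertIdem v := by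
    ext f p u
    simp only [Module.End.mul_apply, repP_apply]
    split_ifs with h1 <;> simp [G.P_mul_P_mul]
  srcMul e := by
    ext f p u
    rw [Module.End.mul_apply, repP_apply]
    cases p with
    | nil =>
      rw [repT_nil]
      by_cases hu : s e = u
      · subst hu
        by_cases hz : s e ∈ Z
        · simp [ValidPath, pathSrc, hz, P_mul_T_mul]
        · simp [G.T_of_not (fun h => hz h.1)]
      · simp [hu]
    | cons e' q =>
      rw [repT_cons]
      by_cases h : e' = e ∧ ValidPath r s H Z (e' :: q) u
      · rw [if_pos h, if_pos ⟨h.2, by rw [pathSrc, h.1]⟩, P_mul_P_mul]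
      · simp [h]
  mulRng e := by
    ext f p u
    rw [Module.End.mul_apply]
    cases p with
    | nil =>
      simp only [repT_nil, repP_apply]
      by_cases hz : r e ∈ H
      · simp [ValidPath, pathSrc, hHZ hz, T_mul_P_mul]
      · simp [G.T_of_not (fun h => hz h.2)]
    | cons e' q =>
      simp only [repT_cons, repP_apply]
      by_cases h : e' = e ∧ ValidPath r s H Z (e' :: q) u
      · rw [if_pos h, if_pos h, if_pos ⟨h.2.2.1, by rw [← h.2.1, h.1]⟩, P_mul_P_mul]
      · simp [h]
  rngMulStar e := by
    ext f p u
    rw [Module.End.mul_apply, repP_apply]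
    simp only [repU_apply]
    by_cases h : ValidPath r s H Z (e :: p) u
    · rw [if_pos ⟨h.2.1, h.1.symm⟩, if_pos h, G.U_of_not (h.not_core hH hHZ)]
      simp [P_mul_P_mul]
    · by_cases h2 : p = [] ∧ u = r e
      · obtain ⟨rfl, rfl⟩ := h2
        by_cases hz : r e ∈ H
        · have hv : ValidPath r s H Z [] (r e) := hHZ hz
          rw [if_pos ⟨hv, rfl⟩, if_neg h, if_pos ⟨rfl, rfl⟩, zero_add, P_mul_U_mul]
        · simp [h, G.U_of_not (fun h => hz h.2)]
      · simp [h, h2]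
  starMulSrc e := by
    ext f p u
    rw [Module.End.mul_apply]
    simp only [repU_apply, repP_apply]
    congr 1
    · by_cases h : ValidPath r s H Z (e :: p) u
      · simp [h, pathSrc, P_mul_P_mul]
      · simp [h]
    · by_cases hz : s e ∈ Z
      · simp [ValidPath, pathSrc, hz, U_mul_P_mul]
      · simp [G.U_of_not (fun h => hz h.1)]
  ck1Orth {e f} hef := by
    ext x p u
    rw [Module.End.mul_apply]
    simp only [repU_apply, repT_cons, repT_nil]
    have : G.U e * (G.T f * x [] (r f)) = 0 := by rw [← mul_assoc, G.ck1Orth hef, zero_mul]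
    simp [hef, this]
  ck1 e := by
    ext f p u
    rw [Module.End.mul_apply]
    simp only [repU_apply, repT_cons, repT_nil, repP_apply]
    by_cases h : ValidPath r s H Z (e :: p) u
    · rw [if_pos (And.intro h.2.1 h.1.symm), G.U_of_not (h.not_core hH hHZ)]
      simp [h, P_mul_P_mul]
    · rw [if_neg h, zero_add]
      by_cases h2 : p = [] ∧ u = r e
      · obtain ⟨rfl, rfl⟩ := h2
        by_cases hz : r e ∈ Z
        · have hc : r e ∈ H ∧ s e ∈ Z := by
            simpa [ValidPath, pathSrc, hz] using h
          simp [ValidPath, pathSrc, hz, ← mul_assoc, G.ck1 e hc.2 hc.1]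
        · have hz' : r e ∉ H := fun h => hz (hHZ h)
          simp [G.U_of_not (fun h => hz' h.2), G.P_of_notMem hz]
      · rw [if_neg h2, if_neg]
        rintro ⟨h3, h4⟩
        cases p with
        | nil => exact h2 ⟨rfl, h4⟩
        | cons e' q => exact h ⟨h4.symm, h3, by simp⟩
  ck2 v hfin hne := by
    ext f p u
    simp only [LinearMap.sum_apply, Finset.sum_apply, Module.End.mul_apply]
    cases p with
    | nil =>
      simp only [repT_nil, repP_apply, repU_apply]
      by_cases huv : u = v
      · subst huv
        by_cases hz : u ∈ Z
        · rw [if_pos ⟨hz, rfl⟩, G.ck2 u hfin hne (hreg u hz hfin hne), Finset.sum_mul]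
          refine Finset.sum_congr rfl fun e he => ?_
          have he : s e = u := by simpa using he
          subst he
          by_cases hr : r e ∈ H
          · simp [ValidPath, pathSrc, hr, hz, mul_assoc]
          · simp [G.T_of_not (fun h => hr h.2)]
        · rw [if_neg (fun h => hz h.1), Finset.sum_eq_zero]
          intro e he
          have he : s e = u := by simpa using he
          subst he
          simp [G.T_of_not (fun h => hz h.1)]
      · rw [if_neg (fun h => huv h.2), Finset.sum_eq_zero]
        intro e he
        have he : s e = v := by simpa using he
        subst he
        rw [if_neg (Ne.symm huv)]
    | cons e' q =>
      simp only [repT_cons, repP_apply, repU_apply]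
      by_cases h : ValidPath r s H Z (e' :: q) u ∧ pathSrc s (e' :: q) u = v
      · obtain ⟨h, rfl⟩ := h
        rw [Finset.sum_eq_single e']
        · simp [h, pathSrc, G.U_of_not (h.not_core hH hHZ), P_mul_P_mul]
        · intro e _ hne
          simp [hne.symm]
        · exact fun h0 => absurd (by simp [pathSrc]) h0
      · rw [if_neg h, Finset.sum_eq_zero]
        intro e he
        have he : s e = v := by simpa using he
        subst he
        rw [if_neg]
        rintro ⟨rfl, h3⟩
        exact h ⟨h3, rfl⟩

/-- The vector supported at a single path. -/
noncomputable def single (p : List E) (u : V) (x : R) : List E → V → R :=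
  fun q w => if q = p ∧ w = u then x else 0

theorem single_apply_self (p : List E) (u : V) (x : R) : single p u x p u = x := by
  simp [single]

include hH hHZ

theorem repT_single {e : E} {p : List E} {u : V} (h : ValidPath r s H Z (e :: p) u) (x : R) :
    G.repT K e (single p u x) = single (e :: p) u (G.P u * x) := by
  ext q w
  cases q with
  | nil => simp [repT_nil, G.T_of_not (h.not_core hH hHZ), single]
  | cons e' q =>
    simp only [repT_cons, single]
    by_cases h2 : (e' = e ∧ q = p) ∧ w = u
    · obtain ⟨⟨rfl, rfl⟩, rfl⟩ := h2
      simp [h]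
    · by_cases h3 : q = p ∧ w = u
      · obtain ⟨rfl, rfl⟩ := h3
        have : e' ≠ e := fun h => h2 ⟨⟨h, rfl⟩, rfl⟩
        simp [this]
      · simp [h2, h3]

variable (hfin : ∀ v ∈ Z, {f : E | s f = v ∧ r f ∉ H}.Finite)

include hfin

theorem rep_gap {v : V} (hv : v ∈ Z) (f : List E → V → R) :
    (G.rep K hH hHZ hreg).gap H v f = single [] v (G.P v * f [] v) := by
  ext p u
  rw [LeavittFamily.gap]
  simp only [LinearMap.sub_apply, LinearMap.sum_apply, Pi.sub_apply, Finset.sum_apply,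
    Module.End.mul_apply, single]
  change G.repP K v f p u - ∑ e ∈ _, G.repT K e (G.repU K e f) p u = _
  cases p with
  | nil =>
    rw [Finset.sum_eq_zero, sub_zero, repP_apply]
    · by_cases huv : u = v
      · subst huv
        simp [ValidPath, pathSrc, hv]
      · simp [pathSrc, huv]
    · intro e he
      have := (LeavittFamily.of_mem_outEdges he).2
      simp [repT_nil, G.T_of_not (fun h => this h.2)]
  | cons e' q =>
    simp only [reduceCtorEq, false_and, if_false]
    rw [repP_apply, sub_eq_zero]
    simp only [repT_cons, repU_apply]
    by_cases h : ValidPath r s H Z (e' :: q) u ∧ pathSrc s (e' :: q) u = v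
    · obtain ⟨h, rfl⟩ := h
      rw [Finset.sum_eq_single e']
      · simp [h, pathSrc, G.U_of_not (h.not_core hH hHZ), P_mul_P_mul]
      · intro e _ hne
        simp [hne.symm]
      · refine fun h0 => absurd ?_ h0
        exact (LeavittFamily.mem_outEdges (hfin _ hv)).2
          ⟨rfl, fun hr => h.not_core hH hHZ ⟨hv, hr⟩⟩
    · rw [if_neg h, Finset.sum_eq_zero]
      intro e he
      rw [if_neg]
      rintro ⟨rfl, h3⟩
      exact h ⟨h3, (LeavittFamily.of_mem_outEdges he).1⟩

theorem rep_mon {p : List E} {u : V} (h : ValidPath r s H Z p u) (f : List E → V → R) :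
    (G.rep K hH hHZ hreg).mon H p u f = single p u (G.P u * f [] u) := by
  induction p with
  | nil => exact G.rep_gap K hH hHZ hreg hfin h f
  | cons e q ih =>
    rw [LeavittFamily.mon, Module.End.mul_apply, ih h.2.1]
    exact (G.repT_single K hH hHZ h _).trans (by rw [P_mul_P_mul])

theorem rep_monStar {p : List E} {u : V} (h : ValidPath r s H Z p u) (f : List E → V → R) :
    (G.rep K hH hHZ hreg).monStar H p u f = single [] u (G.P u * f p u) := by
  induction p generalizing f with
  | nil => exact G.rep_gap K hH hHZ hreg hfin h f
  | cons e q ih =>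
    rw [LeavittFamily.monStar, Module.End.mul_apply, ih h.2.1]
    change single [] u (G.P u * G.repU K e f q u) = _
    rw [repU_apply, if_pos h, G.U_of_not (h.not_core hH hHZ)]
    simp [P_mul_P_mul]

end CoreFamily

end Representation

section BarFamily

variable {r s : E → V} {H S : Set V}

/-- The path in `E` represented by a vertex of the graph `Ē_{(H,S)}`, together with its range. -/
def barPath (r s : E → V) (H S : Set V) : BarV r s H S → List E × V
  | .inl (.inl v) => ([], v.1)
  | .inl (.inr v) => ([], v.1)
  | .inr (.inl p) => (p.1, r (p.1.getLast p.2.choose))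
  | .inr (.inr p) => (p.1, r (p.1.getLast p.2.choose))

/-- The edge of `E` underlying an edge of `Ē_{(H,S)}` with source in `H ∪ S`. -/
def barEdge (r s : E → V) (H S : Set V) :
    {e : E // s e ∈ H} ⊕ {e : E // s e ∈ S ∧ r e ∈ H} → E
  | .inl e => e.1
  | .inr e => e.1

theorem notMem_of_breaking (hH : Hereditary r s H) (hS : S ⊆ breakingVertices r s H) {v : V}
    (hv : v ∈ S) : v ∉ H := by
  obtain ⟨e, rfl, h⟩ := (hS hv).2.2
  exact fun hs => h (hH e hs)

theorem finite_out_notMem (hH : Hereditary r s H) (hS : S ⊆ breakingVertices r s H) (v : V)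
    (hv : v ∈ H ∪ S) : {f : E | s f = v ∧ r f ∉ H}.Finite := by
  rcases hv with hv | hv
  · convert Set.finite_empty
    ext e
    simp only [Set.mem_ofPred_eq, Set.mem_empty_iff_false, iff_false]
    rintro ⟨rfl, h⟩
    exact h (hH e hv)
  · exact (hS hv).2.1

theorem mem_of_regular (hS : S ⊆ breakingVertices r s H) (v : V) (hv : v ∈ H ∪ S)
    (hfin : (s ⁻¹' {v}).Finite) (_ : (s ⁻¹' {v}).Nonempty) : v ∈ H :=
  hv.resolve_right fun h => (hS h).1 hfin

theorem validPath_barPath (x : BarV r s H S)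
    (hH : Hereditary r s H) (hS : S ⊆ breakingVertices r s H) :
    ValidPath r s H (H ∪ S) (barPath r s H S x).1 (barPath r s H S x).2 := by
  rcases x with (v | v) | (⟨p, h, h1, h2, h3⟩ | ⟨p, h, h1, h2⟩)
  · exact Or.inl v.2
  · exact Or.inr v.2
  · exact (validPath_iff h).2 ⟨h1, rfl, .inl h2, fun _ => h3⟩
  · exact (validPath_iff h).2 ⟨h1, rfl, .inr h2, fun h4 => absurd h4 (notMem_of_breaking hH hS h2)⟩

theorem barPath_inr_ne_nil
    (x : {p : List E // p ∈ F1 r s H S} ⊕ {p : List E // p ∈ F2 r s H S}) :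
    (barPath r s H S (.inr x)).1 ≠ [] := by
  rcases x with ⟨p, h, _⟩ | ⟨p, h, _⟩ <;> exact h

theorem barPath_injective (hH : Hereditary r s H) (hS : S ⊆ breakingVertices r s H) :
    Function.Injective (barPath r s H S) := by
  have hd : ∀ v, v ∈ H → v ∈ S → False := fun v h1 h2 => notMem_of_breaking hH hS h2 h1
  rintro ((⟨v, hv⟩ | ⟨v, hv⟩) | (⟨p, hp, hp1, hp2, hp3⟩ | ⟨p, hp, hp1, hp2⟩))
    ((⟨w, hw⟩ | ⟨w, hw⟩) | (⟨q, hq, hq1, hq2, hq3⟩ | ⟨q, hq, hq1, hq2⟩)) h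
  all_goals simp only [barPath, Prod.mk.injEq] at h
  all_goals obtain ⟨h1, h2⟩ := h
  all_goals first | subst h1 | skip
  all_goals first | subst h2 | skip
  all_goals first
    | rfl
    | exact absurd rfl hp
    | exact absurd rfl hq
    | exact (hd _ hv hw).elim
    | exact (hd _ hw hv).elim
    | exact (hd _ hp2 hq2).elim
    | exact (hd _ hq2 hp2).elim

theorem exists_barPath_inr {p : List E} {u : V} (hp : p ≠ [])
    (h : ValidPath r s H (H ∪ S) p u) : ∃ x, barPath r s H S (.inr x) = (p, u) := by
  obtain ⟨h1, rfl, h2 | h2, h3⟩ := (validPath_iff hp).1 h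
  · exact ⟨.inl ⟨p, hp, h1, h2, h3 h2⟩, rfl⟩
  · exact ⟨.inr ⟨p, hp, h1, h2⟩, rfl⟩

theorem exists_barPath_inl {u : V} (h : u ∈ H ∪ S) : ∃ x, barPath r s H S (.inl x) = ([], u) := by
  rcases h with h | h
  · exact ⟨.inl ⟨u, h⟩, rfl⟩
  · exact ⟨.inr ⟨u, h⟩, rfl⟩

theorem barEdge_injective (hH : Hereditary r s H) (hS : S ⊆ breakingVertices r s H) :
    Function.Injective (barEdge r s H S) := by
  rintro (⟨e, he⟩ | ⟨e, he⟩) (⟨f, hf⟩ | ⟨f, hf⟩) (rfl : e = f)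
  · rfl
  · exact absurd he (notMem_of_breaking hH hS hf.1)
  · exact absurd hf (notMem_of_breaking hH hS he.1)
  · rfl

theorem exists_barEdge {e : E} (hs : s e ∈ H ∪ S) (hr : r e ∈ H) :
    ∃ b, barEdge r s H S b = e := by
  rcases hs with hs | hs
  · exact ⟨.inl ⟨e, hs⟩, rfl⟩
  · exact ⟨.inr ⟨e, hs, hr⟩, rfl⟩

theorem s_barEdge_mem (b : {e : E // s e ∈ H} ⊕ {e : E // s e ∈ S ∧ r e ∈ H}) :
    s (barEdge r s H S b) ∈ H ∪ S := by
  rcases b with e | e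
  · exact .inl e.2
  · exact .inr e.2.1

theorem r_barEdge_mem (hH : Hereditary r s H)
    (b : {e : E // s e ∈ H} ⊕ {e : E // s e ∈ S ∧ r e ∈ H}) :
    r (barEdge r s H S b) ∈ H := by
  rcases b with e | e
  · exact hH _ e.2
  · exact e.2.2

theorem barPath_barS_inl (b : {e : E // s e ∈ H} ⊕ {e : E // s e ∈ S ∧ r e ∈ H}) :
    barPath r s H S (barS r s H S (.inl b)) = ([], s (barEdge r s H S b)) := by
  rcases b with e | e <;> rfl

theorem barS_inr (x : {p : List E // p ∈ F1 r s H S} ⊕ {p : List E // p ∈ F2 r s H S}) :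
    barS r s H S (.inr x) = .inr x := by
  rcases x with e | e <;> rfl

theorem barPath_barR_inl (hH : Hereditary r s H)
    (b : {e : E // s e ∈ H} ⊕ {e : E // s e ∈ S ∧ r e ∈ H}) :
    barPath r s H S (barR r s H S hH (.inl b)) = ([], r (barEdge r s H S b)) := by
  rcases b with e | e <;> rfl

theorem barPath_barR_inr (hH : Hereditary r s H)
    (x : {p : List E // p ∈ F1 r s H S} ⊕ {p : List E // p ∈ F2 r s H S}) :
    barPath r s H S (barR r s H S hH (.inr x)) = ([], (barPath r s H S (.inr x)).2) := by
  rcases x with e | e <;> rfl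

namespace LeavittFamily

variable {A : Type*} [Ring A] (F : LeavittFamily r s A)

/-- The image of a vertex of `Ē_{(H,S)}`. -/
noncomputable def barP (H S : Set V) (x : BarV r s H S) : A :=
  F.mon H (barPath r s H S x).1 (barPath r s H S x).2 *
    F.monStar H (barPath r s H S x).1 (barPath r s H S x).2

/-- The image of an edge of `Ē_{(H,S)}`. -/
noncomputable def barT (H S : Set V) : BarE r s H S → A
  | .inl b => F.T (barEdge r s H S b)
  | .inr x => F.mon H (barPath r s H S (.inr x)).1 (barPath r s H S (.inr x)).2

/-- The image of a ghost edge of `Ē_{(H,S)}`. -/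
noncomputable def barU (H S : Set V) : BarE r s H S → A
  | .inl b => F.U (barEdge r s H S b)
  | .inr x => F.monStar H (barPath r s H S (.inr x)).1 (barPath r s H S (.inr x)).2

variable (hH : Hereditary r s H) (hS : S ⊆ breakingVertices r s H)

include hH hS

theorem barP_of_nil {x : BarV r s H S} {u : V} (h : barPath r s H S x = ([], u)) :
    F.barP H S x = F.gap H u := by
  rw [barP, h]
  have := validPath_barPath x hH hS
  rw [h] at this
  exact F.gap_mul_gap (finite_out_notMem hH hS u this)

theorem barP_mul_self (x : BarV r s H S) : F.barP H S x * F.barP H S x = F.barP H S x := by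
  have hf := finite_out_notMem hH hS
  have hx := validPath_barPath x hH hS
  rw [barP, mul_assoc, ← mul_assoc (F.monStar _ _ _), F.monStar_mul_mon hf hx,
    F.gap_mul_monStar hf hx.mem]

theorem barP_barS_mul_barT (e : BarE r s H S) :
    F.barP H S (barS r s H S e) * F.barT H S e = F.barT H S e := by
  have hf := finite_out_notMem hH hS
  rcases e with b | x
  · rw [F.barP_of_nil hH hS (barPath_barS_inl b)]
    exact F.gap_mul_T (r_barEdge_mem hH b)
  · have hx := validPath_barPath (.inr x) hH hS
    rw [barS_inr, barP, barT, mul_assoc, F.monStar_mul_mon hf hx, F.mon_mul_gap hf hx.mem]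

theorem barU_mul_barP_barS (e : BarE r s H S) :
    F.barU H S e * F.barP H S (barS r s H S e) = F.barU H S e := by
  have hf := finite_out_notMem hH hS
  rcases e with b | x
  · rw [F.barP_of_nil hH hS (barPath_barS_inl b)]
    exact F.U_mul_gap (r_barEdge_mem hH b)
  · have hx := validPath_barPath (.inr x) hH hS
    rw [barS_inr, barP, barU, ← mul_assoc, F.monStar_mul_mon hf hx, F.gap_mul_monStar hf hx.mem]

theorem barP_mul_barP_of_ne {x y : BarV r s H S} (h : x ≠ y) :
    F.barP H S x * F.barP H S y = 0 := by
  have hf := finite_out_notMem hH hS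
  have hx := validPath_barPath x hH hS
  have hy := validPath_barPath y hH hS
  rw [barP, barP, mul_assoc, ← mul_assoc (F.monStar _ _ _),
    F.monStar_mul_mon_of_ne hH Set.subset_union_left hf hx hy
      (fun he => h (barPath_injective hH hS he)), zero_mul, mul_zero]

/-- The Leavitt family of `Ē_{(H,S)}` associated to a Leavitt family of `E`. -/
noncomputable def bar : LeavittFamily (barR r s H S hH) (barS r s H S) A where
  P := F.barP H S
  T := F.barT H S
  U := F.barU H S
  vertOrth h := F.barP_mul_barP_of_ne hH hS h
  vertIdem x := F.barP_mul_self hH hS x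
  srcMul e := F.barP_barS_mul_barT hH hS e
  starMulSrc e := F.barU_mul_barP_barS hH hS e
  mulRng e := by
    have hf := finite_out_notMem hH hS
    rcases e with b | x
    · rw [F.barP_of_nil hH hS (barPath_barR_inl hH b), F.gap_eq_P hH (r_barEdge_mem hH b)]
      exact F.mulRng _
    · rw [F.barP_of_nil hH hS (barPath_barR_inr hH x)]
      exact F.mon_mul_gap hf (validPath_barPath (.inr x) hH hS).mem
  rngMulStar e := by
    have hf := finite_out_notMem hH hS
    rcases e with b | x
    · rw [F.barP_of_nil hH hS (barPath_barR_inl hH b), F.gap_eq_P hH (r_barEdge_mem hH b)]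
      exact F.rngMulStar _
    · rw [F.barP_of_nil hH hS (barPath_barR_inr hH x)]
      exact F.gap_mul_monStar hf (validPath_barPath (.inr x) hH hS).mem
  ck1Orth {e f} hef := by
    by_cases h : barS r s H S e = barS r s H S f
    · rcases e with b | x <;> rcases f with c | y
      · exact F.ck1Orth fun he => hef (congrArg _ (barEdge_injective hH hS he))
      · rw [barS_inr] at h
        rcases b with b | b <;> cases h
      · rw [barS_inr] at h
        rcases c with c | c <;> cases h
      · rw [barS_inr, barS_inr] at h
        exact absurd (congrArg Sum.inr (Sum.inr_injective h)) hef
    · rw [← F.barU_mul_barP_barS hH hS, ← F.barP_barS_mul_barT hH hS, mul_assoc,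
        ← mul_assoc (F.barP _ _ _), F.barP_mul_barP_of_ne hH hS h, zero_mul, mul_zero]
  ck1 e := by
    have hf := finite_out_notMem hH hS
    rcases e with b | x
    · rw [F.barP_of_nil hH hS (barPath_barR_inl hH b), F.gap_eq_P hH (r_barEdge_mem hH b)]
      exact F.ck1 _
    · rw [F.barP_of_nil hH hS (barPath_barR_inr hH x)]
      exact F.monStar_mul_mon hf (validPath_barPath (.inr x) hH hS)
  ck2 x hfin hne := by
    rcases x with (v | v) | x
    · have hs : ∀ {e}, s e = v.1 → s e ∈ H := fun he => he ▸ v.2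
      have hfin' : (s ⁻¹' {v.1}).Finite := by
        refine ((hfin.preimage Sum.inl_injective.injOn).image (barEdge r s H S)).subset ?_
        intro e (he : s e = v.1)
        exact ⟨.inl ⟨e, hs he⟩, by simp [barS, he], rfl⟩
      have hmem : ∀ e, e ∈ hfin.toFinset → ∃ f, ∃ hf : s f = v.1, .inl (.inl ⟨f, hs hf⟩) = e := by
        intro e he
        have he : barS r s H S e = .inl (.inl v) := by simpa using he
        rcases e with (e | e) | y
        · exact ⟨e.1, congrArg Subtype.val (Sum.inl_injective (Sum.inl_injective he)), rfl⟩
        · cases he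
        · rw [barS_inr] at he
          cases he
      have hne' : (s ⁻¹' {v.1}).Nonempty := by
        obtain ⟨e, he⟩ := hne
        obtain ⟨f, hf, -⟩ := hmem e (by simpa using he)
        exact ⟨f, hf⟩
      rw [F.barP_of_nil hH hS (show barPath r s H S _ = ([], v.1) from rfl), F.gap_eq_P hH v.2,
        F.ck2 v.1 hfin' hne']
      refine Finset.sum_bij (fun e he => .inl (.inl ⟨e, hs (by simpa using he)⟩)) ?_ ?_ ?_ ?_
      · intro e he
        have he : s e = v.1 := by simpa using he
        simp [barS, he]
      · intro e _ f _ hef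
        exact congrArg Subtype.val (Sum.inl_injective (Sum.inl_injective hef))
      · intro e he
        obtain ⟨f, hf, rfl⟩ := hmem e he
        exact ⟨f, by simpa using hf, rfl⟩
      · intro e he
        rfl
    · refine absurd ?_ (hS v.2).1
      refine ((hS v.2).2.1.union
        ((hfin.preimage Sum.inl_injective.injOn).image (barEdge r s H S))).subset ?_
      intro e (he : s e = v.1)
      by_cases hr : r e ∈ H
      · exact .inr ⟨.inr ⟨e, he ▸ v.2, hr⟩, by simp [barS, he], rfl⟩
      · exact .inl ⟨he, hr⟩
    · have hset : hfin.toFinset = {.inr x} := by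
        ext e
        rcases e with (b | b) | y
        · simp [barS]
        · simp [barS]
        · simp [barS_inr]
      rw [hset, Finset.sum_singleton]
      rfl

end LeavittFamily

end BarFamily

section Injectivity

namespace CoreFamily

variable {r s : E → V} {H Z : Set V} {R : Type*} [Ring R] [Algebra K R]
  (G : CoreFamily r s H Z R)

theorem repT_core (hH : Hereditary r s H) (hHZ : H ⊆ Z) {e : E} (hs : s e ∈ Z) (hr : r e ∈ H)
    (f : List E → V → R) : G.repT K e f = single [] (s e) (G.T e * f [] (r e)) := by
  ext p u
  cases p with
  | nil =>
    rw [repT_nil]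
    by_cases h : s e = u
    · simp [single, h]
    · simp [single, h, Ne.symm h]
  | cons e' q =>
    rw [repT_cons, if_neg]
    · simp [single]
    · rintro ⟨rfl, h⟩
      exact h.not_core hH hHZ ⟨hs, hr⟩

theorem repU_core (hH : Hereditary r s H) (hHZ : H ⊆ Z) {e : E} (hs : s e ∈ Z) (hr : r e ∈ H)
    (f : List E → V → R) : G.repU K e f = single [] (r e) (G.U e * f [] (s e)) := by
  ext p u
  rw [repU_apply, if_neg fun h => h.not_core hH hHZ ⟨hs, hr⟩, zero_add]
  rfl

end CoreFamily

namespace LeavittFamily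

variable {r s : E → V} {H S : Set V} {hH : Hereditary r s H} {R : Type*} [Ring R]
  (G : LeavittFamily (barR r s H S hH) (barS r s H S) R)

/-- The element of a Leavitt family of `Ē_{(H,S)}` which is the ghost edge leaving a vertex given
by a path of positive length, and the vertex itself for the vertices in `H ∪ S`. -/
def barCoeff : BarV r s H S → R
  | .inl v => G.P (.inl v)
  | .inr x => G.U (.inr x)

open scoped Classical in
/-- The element `barCoeff` as a function of the path, extended by zero. -/
noncomputable def pathCoeff (p : List E) (u : V) : R :=
  if h : ∃ x, barPath r s H S x = (p, u) then G.barCoeff h.choose else 0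

open scoped Classical in
/-- The edge of `Ē_{(H,S)}` corresponding to an edge from `H ∪ S` to `H`, or zero. -/
noncomputable def coreT (e : E) : R :=
  if h : ∃ b, barEdge r s H S b = e then G.T (.inl h.choose) else 0

open scoped Classical in
/-- The ghost edge of `Ē_{(H,S)}` corresponding to an edge from `H ∪ S` to `H`, or zero. -/
noncomputable def coreU (e : E) : R :=
  if h : ∃ b, barEdge r s H S b = e then G.U (.inl h.choose) else 0

theorem pathCoeff_of_forall {p : List E} {u : V} (h : ∀ x, barPath r s H S x ≠ (p, u)) :
    G.pathCoeff p u = 0 :=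
  dif_neg fun ⟨x, hx⟩ => h x hx

theorem coreT_of_forall {e : E} (h : ∀ b, barEdge r s H S b ≠ e) : G.coreT e = 0 :=
  dif_neg fun ⟨x, hx⟩ => h x hx

theorem coreU_of_forall {e : E} (h : ∀ b, barEdge r s H S b ≠ e) : G.coreU e = 0 :=
  dif_neg fun ⟨x, hx⟩ => h x hx

theorem barCoeff_mul_P (x : BarV r s H S) : G.barCoeff x * G.P x = G.barCoeff x := by
  rcases x with v | x
  · exact G.vertIdem _
  · have := G.starMulSrc (.inr x)
    rwa [barS_inr] at this

theorem P_eq_zero_of_barCoeff {x : BarV r s H S} {b : R} (h : G.barCoeff x * b = 0) :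
    G.P x * b = 0 := by
  rcases x with v | x
  · exact h
  · have hset : barS r s H S ⁻¹' {.inr x} = {.inr x} := by
      ext e
      rcases e with (b | b) | y
      · simp [barS]
      · simp [barS]
      · simp [barS_inr]
    have hfin : (barS r s H S ⁻¹' {.inr x}).Finite := hset ▸ Set.finite_singleton _
    have hx := G.ck2 (.inr x) hfin (hset ▸ Set.singleton_nonempty _)
    have hset' : hfin.toFinset = {.inr x} := by
      ext e
      simp [hset]
    rw [hset', Finset.sum_singleton] at hx
    rw [hx, mul_assoc]
    exact (congrArg _ h).trans (mul_zero _)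

variable (hS : S ⊆ breakingVertices r s H)

include hS

theorem pathCoeff_of_eq {x : BarV r s H S} {p : List E} {u : V}
    (h : barPath r s H S x = (p, u)) : G.pathCoeff p u = G.barCoeff x := by
  have hex : ∃ x, barPath r s H S x = (p, u) := ⟨x, h⟩
  rw [pathCoeff, dif_pos hex]
  congr 1
  exact barPath_injective hH hS (hex.choose_spec.trans h.symm)

theorem pathCoeff_nil_of_eq {x : BarV r s H S} {u : V}
    (h : barPath r s H S x = ([], u)) : G.pathCoeff [] u = G.P x := by
  rw [G.pathCoeff_of_eq hS h]
  rcases x with v | x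
  · rfl
  · exact absurd (congrArg Prod.fst h) (barPath_inr_ne_nil x)

theorem coreT_barEdge (b) : G.coreT (barEdge r s H S b) = G.T (.inl b) := by
  have hex : ∃ c, barEdge r s H S c = barEdge r s H S b := ⟨b, rfl⟩
  rw [coreT, dif_pos hex, barEdge_injective hH hS hex.choose_spec]

theorem coreU_barEdge (b) : G.coreU (barEdge r s H S b) = G.U (.inl b) := by
  have hex : ∃ c, barEdge r s H S c = barEdge r s H S b := ⟨b, rfl⟩
  rw [coreU, dif_pos hex, barEdge_injective hH hS hex.choose_spec]

/-- The core family associated to a Leavitt family of `Ē_{(H,S)}`. -/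
noncomputable def core : CoreFamily r s H (H ∪ S) R where
  P := G.pathCoeff []
  T := G.coreT
  U := G.coreU
  P_of_notMem {v} hv := by
    refine G.pathCoeff_of_forall fun x hx => hv ?_
    have := validPath_barPath x hH hS
    rwa [hx] at this
  T_of_not {e} he := by
    refine G.coreT_of_forall fun b hb => he ?_
    subst hb
    exact ⟨s_barEdge_mem b, r_barEdge_mem hH b⟩
  U_of_not {e} he := by
    refine G.coreU_of_forall fun b hb => he ?_
    subst hb
    exact ⟨s_barEdge_mem b, r_barEdge_mem hH b⟩
  vertIdem v := by
    by_cases h : ∃ x, barPath r s H S x = ([], v)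
    · obtain ⟨x, hx⟩ := h
      rw [G.pathCoeff_nil_of_eq hS hx, G.vertIdem]
    · rw [G.pathCoeff_of_forall (not_exists.1 h), zero_mul]
  srcMul e := by
    by_cases h : ∃ b, barEdge r s H S b = e
    · obtain ⟨b, rfl⟩ := h
      rw [G.pathCoeff_nil_of_eq hS (barPath_barS_inl b), G.coreT_barEdge hS, G.srcMul]
    · rw [G.coreT_of_forall (not_exists.1 h), mul_zero]
  mulRng e := by
    by_cases h : ∃ b, barEdge r s H S b = e
    · obtain ⟨b, rfl⟩ := h
      rw [G.pathCoeff_nil_of_eq hS (barPath_barR_inl hH b), G.coreT_barEdge hS, G.mulRng]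
    · rw [G.coreT_of_forall (not_exists.1 h), zero_mul]
  rngMulStar e := by
    by_cases h : ∃ b, barEdge r s H S b = e
    · obtain ⟨b, rfl⟩ := h
      rw [G.pathCoeff_nil_of_eq hS (barPath_barR_inl hH b), G.coreU_barEdge hS, G.rngMulStar]
    · rw [G.coreU_of_forall (not_exists.1 h), mul_zero]
  starMulSrc e := by
    by_cases h : ∃ b, barEdge r s H S b = e
    · obtain ⟨b, rfl⟩ := h
      rw [G.pathCoeff_nil_of_eq hS (barPath_barS_inl b), G.coreU_barEdge hS, G.starMulSrc]
    · rw [G.coreU_of_forall (not_exists.1 h), zero_mul]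
  ck1Orth {e f} hef := by
    by_cases h : ∃ b, barEdge r s H S b = e
    · by_cases h' : ∃ b, barEdge r s H S b = f
      · obtain ⟨b, rfl⟩ := h
        obtain ⟨c, rfl⟩ := h'
        rw [G.coreU_barEdge hS, G.coreT_barEdge hS, G.ck1Orth]
        intro h
        exact hef (congrArg _ (Sum.inl_injective h))
      · rw [G.coreT_of_forall (not_exists.1 h'), mul_zero]
    · rw [G.coreU_of_forall (not_exists.1 h), zero_mul]
  ck1 e hs hr := by
    obtain ⟨b, rfl⟩ := exists_barEdge hs hr
    rw [G.coreU_barEdge hS, G.coreT_barEdge hS, G.ck1,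
      G.pathCoeff_nil_of_eq hS (barPath_barR_inl hH b)]
  ck2 v hfin hne hv := by
    have hs : ∀ {e}, s e = v → s e ∈ H := fun he => he ▸ hv
    have hset : barS r s H S ⁻¹' {.inl (.inl ⟨v, hv⟩)} =
        (fun e : {e // s e ∈ H} => .inl (.inl e)) '' (Subtype.val ⁻¹' (s ⁻¹' {v})) := by
      ext e
      rcases e with (e | e) | y
      · simp [barS]
      · simp [barS]
      · simp [barS_inr]
    have hfin' : (barS r s H S ⁻¹' {.inl (.inl ⟨v, hv⟩)}).Finite := by
      rw [hset]
      exact (hfin.preimage Subtype.val_injective.injOn).image _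
    have hne' : (barS r s H S ⁻¹' {.inl (.inl ⟨v, hv⟩)}).Nonempty := by
      obtain ⟨e, he⟩ := hne
      rw [hset]
      exact ⟨_, ⟨e, hs he⟩, he, rfl⟩
    rw [G.pathCoeff_nil_of_eq hS (show barPath r s H S (.inl (.inl ⟨v, hv⟩)) = ([], v) from rfl),
      G.ck2 _ hfin' hne']
    symm
    refine Finset.sum_bij (fun e he => .inl (.inl ⟨e, hs (by simpa using he)⟩)) ?_ ?_ ?_ ?_
    · intro e he
      have he : s e = v := by simpa using he
      simp [barS, he]
    · intro e _ f _ hef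
      exact congrArg Subtype.val (Sum.inl_injective (Sum.inl_injective hef))
    · intro e he
      rw [Set.Finite.mem_toFinset, hset] at he
      obtain ⟨f, hf, rfl⟩ := he
      exact ⟨f.1, by simpa using hf, rfl⟩
    · intro e he
      have he : s e = v := by simpa using he
      rw [← G.coreT_barEdge hS, ← G.coreU_barEdge hS]
      rfl

theorem core_P_mul_barCoeff (x : BarV r s H S) :
    (G.core hS).P (barPath r s H S x).2 * G.barCoeff x = G.barCoeff x := by
  change G.pathCoeff [] _ * _ = _
  rcases x with x | x
  · rw [G.pathCoeff_nil_of_eq hS (x := .inl x) (by rcases x with x | x <;> rfl)]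
    exact G.vertIdem _
  · rw [G.pathCoeff_nil_of_eq hS (barPath_barR_inr hH x)]
    exact G.rngMulStar (.inr x)

theorem pathCoeff_mul_P_of_ne {x : BarV r s H S} {p : List E} {u : V}
    (h : barPath r s H S x ≠ (p, u)) : G.pathCoeff p u * G.P x = 0 := by
  by_cases h' : ∃ y, barPath r s H S y = (p, u)
  · obtain ⟨y, hy⟩ := h'
    rw [G.pathCoeff_of_eq hS hy, ← G.barCoeff_mul_P, mul_assoc, G.vertOrth, mul_zero]
    rintro rfl
    exact h hy
  · rw [G.pathCoeff_of_forall (not_exists.1 h'), zero_mul]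

/-- Multiplication by the path coefficients, as a vector indexed by paths. -/
noncomputable def pathVector (c : R) : List E → V → R := fun p u => G.pathCoeff p u * c

theorem pathVector_eq_single {x : BarV r s H S} {p : List E} {u : V}
    (hx : barPath r s H S x = (p, u)) {y : R} (h : G.P x * y = y) :
    G.pathVector y = CoreFamily.single p u (G.barCoeff x * y) := by
  ext q w
  rw [pathVector, CoreFamily.single]
  by_cases hq : q = p ∧ w = u
  · obtain ⟨rfl, rfl⟩ := hq
    rw [if_pos ⟨rfl, rfl⟩, G.pathCoeff_of_eq hS hx]
  · have hne : barPath r s H S x ≠ (q, w) := by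
      rw [hx]
      rintro ⟨⟩
      exact hq ⟨rfl, rfl⟩
    conv_lhs => rw [← h]
    rw [if_neg hq, ← mul_assoc, G.pathCoeff_mul_P_of_ne hS hne, zero_mul]

variable [Algebra K R]

/-- The Leavitt family of `E` acting on vectors indexed by paths with coefficients in an algebra
containing a Leavitt family of `Ē_{(H,S)}`. -/
noncomputable def pathRep : LeavittFamily r s (Module.End K (List E → V → R)) :=
  (G.core hS).rep K hH Set.subset_union_left (mem_of_regular hS)

theorem pathRep_mon {x : BarV r s H S} {p : List E} {u : V} (hx : barPath r s H S x = (p, u))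
    (f : List E → V → R) : (G.pathRep K hS).mon H p u f =
      CoreFamily.single p u ((G.core hS).P u * f [] u) := by
  have := validPath_barPath x hH hS
  rw [hx] at this
  exact (G.core hS).rep_mon K hH Set.subset_union_left _ (finite_out_notMem hH hS) this f

theorem pathRep_monStar {x : BarV r s H S} {p : List E} {u : V}
    (hx : barPath r s H S x = (p, u)) (f : List E → V → R) : (G.pathRep K hS).monStar H p u f =
      CoreFamily.single [] u ((G.core hS).P u * f p u) := by
  have := validPath_barPath x hH hS
  rw [hx] at this
  exact (G.core hS).rep_monStar K hH Set.subset_union_left _ (finite_out_notMem hH hS) this f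

theorem bar_P_pathVector (x : BarV r s H S) (c : R) :
    ((G.pathRep K hS).bar hH hS).P x (G.pathVector c) = G.pathVector (G.P x * c) := by
  have hx : barPath r s H S x = ((barPath r s H S x).1, (barPath r s H S x).2) := rfl
  change ((G.pathRep K hS).mon H _ _ * (G.pathRep K hS).monStar H _ _) _ = _
  rw [Module.End.mul_apply, G.pathRep_monStar K hS hx, G.pathRep_mon K hS hx,
    G.pathVector_eq_single hS hx (y := G.P x * c) (by rw [← mul_assoc, G.vertIdem]), ← mul_assoc,
    G.barCoeff_mul_P, pathVector, G.pathCoeff_of_eq hS hx, CoreFamily.single_apply_self,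
    CoreFamily.P_mul_P_mul, ← mul_assoc, G.core_P_mul_barCoeff hS]

theorem bar_T_pathVector (e : BarE r s H S) (c : R) :
    ((G.pathRep K hS).bar hH hS).T e (G.pathVector c) = G.pathVector (G.T e * c) := by
  have hs : G.P (barS r s H S e) * (G.T e * c) = G.T e * c := by rw [← mul_assoc, G.srcMul]
  rcases e with b | x
  · rw [G.pathVector_eq_single hS (barPath_barS_inl b) hs,
      ← G.pathCoeff_of_eq hS (barPath_barS_inl b), G.pathCoeff_nil_of_eq hS (barPath_barS_inl b),
      hs]
    refine ((G.core hS).repT_core K hH Set.subset_union_left (s_barEdge_mem b)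
      (r_barEdge_mem hH b) _).trans ?_
    change CoreFamily.single _ _ (G.coreT _ * (G.pathCoeff _ _ * c)) = _
    rw [G.coreT_barEdge hS, G.pathCoeff_nil_of_eq hS (barPath_barR_inl hH b), ← mul_assoc,
      G.mulRng]
  · have hx : barPath r s H S (.inr x) =
        ((barPath r s H S (.inr x)).1, (barPath r s H S (.inr x)).2) := rfl
    rw [barS_inr] at hs
    rw [G.pathVector_eq_single hS hx hs]
    refine (G.pathRep_mon K hS hx _).trans ?_
    change CoreFamily.single _ _ (G.pathCoeff _ _ * (G.pathCoeff _ _ * c)) =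
      CoreFamily.single _ _ (G.U (.inr x) * (G.T (.inr x) * c))
    rw [G.pathCoeff_nil_of_eq hS (barPath_barR_inr hH x), ← mul_assoc, ← mul_assoc, G.vertIdem,
      G.ck1]

theorem bar_U_pathVector (e : BarE r s H S) (c : R) :
    ((G.pathRep K hS).bar hH hS).U e (G.pathVector c) = G.pathVector (G.U e * c) := by
  have hr : G.P (barR r s H S hH e) * (G.U e * c) = G.U e * c := by
    rw [← mul_assoc, G.rngMulStar]
  rcases e with b | x
  · rw [G.pathVector_eq_single hS (barPath_barR_inl hH b) hr,
      ← G.pathCoeff_of_eq hS (barPath_barR_inl hH b),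
      G.pathCoeff_nil_of_eq hS (barPath_barR_inl hH b), hr]
    refine ((G.core hS).repU_core K hH Set.subset_union_left (s_barEdge_mem b)
      (r_barEdge_mem hH b) _).trans ?_
    change CoreFamily.single _ _ (G.coreU _ * (G.pathCoeff _ _ * c)) = _
    rw [G.coreU_barEdge hS, G.pathCoeff_nil_of_eq hS (barPath_barS_inl b), ← mul_assoc,
      G.starMulSrc]
  · have hx : barPath r s H S (.inr x) =
        ((barPath r s H S (.inr x)).1, (barPath r s H S (.inr x)).2) := rfl
    rw [G.pathVector_eq_single hS (barPath_barR_inr hH x) hr,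
      ← G.pathCoeff_of_eq hS (barPath_barR_inr hH x),
      G.pathCoeff_nil_of_eq hS (barPath_barR_inr hH x), hr]
    refine (G.pathRep_monStar K hS hx _).trans ?_
    change CoreFamily.single _ _ (G.pathCoeff _ _ * (G.pathCoeff _ _ * c)) = _
    rw [G.pathCoeff_nil_of_eq hS (barPath_barR_inr hH x), G.pathCoeff_of_eq hS hx]
    exact congrArg _ hr

end LeavittFamily

end Injectivity
section Homomorphism

namespace LeavittFamily

variable {K} {r s : E → V} {H S : Set V} {A : Type*} [Ring A] [Algebra K A]
  (F : LeavittFamily r s A)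

theorem lift_gap (v : V) : F.lift ((univ K r s).gap H v) = F.gap H v := by
  simp [gap, univ]

theorem lift_mon (p : List E) (u : V) : F.lift ((univ K r s).mon H p u) = F.mon H p u := by
  induction p with
  | nil => exact F.lift_gap u
  | cons e q ih => rw [mon, mon, map_mul, ih, univ, lift_edge]

theorem lift_monStar (p : List E) (u : V) :
    F.lift ((univ K r s).monStar H p u) = F.monStar H p u := by
  induction p with
  | nil => exact F.lift_gap u
  | cons e q ih => rw [monStar, monStar, map_mul, ih, univ, lift_ghost]

theorem lift_barP (x : BarV r s H S) : F.lift ((univ K r s).barP H S x) = F.barP H S x := by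
  rw [barP, map_mul, lift_mon, lift_monStar, barP]

theorem lift_barT (e : BarE r s H S) : F.lift ((univ K r s).barT H S e) = F.barT H S e := by
  rcases e with b | x
  · exact F.lift_edge _
  · exact F.lift_mon _ _

theorem lift_barU (e : BarE r s H S) : F.lift ((univ K r s).barU H S e) = F.barU H S e := by
  rcases e with b | x
  · exact F.lift_ghost _
  · exact F.lift_monStar _ _

end LeavittFamily

variable {r s : E → V} {H S : Set V} (hH : Hereditary r s H) (hS : S ⊆ breakingVertices r s H)

/-- The homomorphism from the Leavitt path algebra of `Ē_{(H,S)}` to that of `E`. -/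
noncomputable def barHom : LPA K (barR r s H S hH) (barS r s H S) →ₐ[K] LPA K r s :=
  ((LeavittFamily.univ K r s).bar hH hS).lift

open LeavittFamily in
theorem pathRep_lift_barHom {b : LPA K (barR r s H S hH) (barS r s H S)}
    (hb : b ∈ LPAproper K (barR r s H S hH) (barS r s H S))
    (c : LPA K (barR r s H S hH) (barS r s H S)) :
    ((univ K (barR r s H S hH) (barS r s H S)).pathRep K hS).lift (barHom K hH hS b)
        ((univ K (barR r s H S hH) (barS r s H S)).pathVector c) =
      (univ K (barR r s H S hH) (barS r s H S)).pathVector (b * c) := by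
  induction hb using NonUnitalAlgebra.adjoin_induction generalizing c with
  | mem x hx =>
    obtain (⟨x, rfl⟩ | ⟨x, rfl⟩) | ⟨x, rfl⟩ := hx
    · rw [barHom, lift_vert]
      exact (DFunLike.congr_fun (lift_barP _ x) _).trans (bar_P_pathVector K _ hS x c)
    · rw [barHom, lift_edge]
      exact (DFunLike.congr_fun (lift_barT _ x) _).trans (bar_T_pathVector K _ hS x c)
    · rw [barHom, lift_ghost]
      exact (DFunLike.congr_fun (lift_barU _ x) _).trans (bar_U_pathVector K _ hS x c)
  | add x y _ _ hx hy =>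
    rw [map_add, map_add, LinearMap.add_apply, hx, hy, add_mul]
    ext p u
    exact (mul_add _ _ _).symm
  | zero =>
    rw [map_zero, map_zero, LinearMap.zero_apply, zero_mul]
    ext p u
    exact (mul_zero _).symm
  | mul x y _ _ hx hy => rw [map_mul, map_mul, Module.End.mul_apply, hy, hx, mul_assoc]
  | smul k x _ hx =>
    rw [map_smul, map_smul, LinearMap.smul_apply, hx, smul_mul_assoc]
    ext p u
    exact (mul_smul_comm k (pathCoeff _ p u) (x * c)).symm

theorem exists_vert_sum_mul (r s : E → V) {b : LPA K r s} (hb : b ∈ LPAproper K r s) :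
    ∃ F : Finset V, ∀ F', F ⊆ F' → (∑ v ∈ F', vert K r s v) * b = b := by
  classical
  have key : ∀ (v : V) (b : LPA K r s), vert K r s v * b = b →
      ∃ F : Finset V, ∀ F', F ⊆ F' → (∑ v ∈ F', vert K r s v) * b = b := by
    intro v b hb
    refine ⟨{v}, fun F' hF' => ?_⟩
    rw [Finset.sum_mul, Finset.sum_eq_single v, hb]
    · intro w _ hw
      have h : vert K r s w * vert K r s v = 0 := (LeavittFamily.univ K r s).vertOrth hw
      rw [← hb, ← mul_assoc, h, zero_mul]
    · exact fun h => absurd (hF' (Finset.mem_singleton_self v)) h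
  induction hb using NonUnitalAlgebra.adjoin_induction with
  | mem x hx =>
    obtain (⟨x, rfl⟩ | ⟨x, rfl⟩) | ⟨x, rfl⟩ := hx
    · exact key x _ ((LeavittFamily.univ K r s).vertIdem x)
    · exact key _ _ ((LeavittFamily.univ K r s).srcMul x)
    · exact key _ _ ((LeavittFamily.univ K r s).rngMulStar x)
  | add x y _ _ hx hy =>
    obtain ⟨F, hF⟩ := hx
    obtain ⟨F', hF'⟩ := hy
    refine ⟨F ∪ F', fun F'' h => ?_⟩
    rw [mul_add, hF _ (Finset.union_subset_left h), hF' _ (Finset.union_subset_right h)]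
  | zero => exact ⟨∅, fun _ _ => mul_zero _⟩
  | mul x y _ _ hx _ =>
    obtain ⟨F, hF⟩ := hx
    exact ⟨F, fun F' h => by rw [← mul_assoc, hF F' h]⟩
  | smul k x _ hx =>
    obtain ⟨F, hF⟩ := hx
    exact ⟨F, fun F' h => by rw [mul_smul_comm, hF F' h]⟩

theorem eq_zero_of_barHom_eq_zero {b : LPA K (barR r s H S hH) (barS r s H S)}
    (hb : b ∈ LPAproper K (barR r s H S hH) (barS r s H S)) (h : barHom K hH hS b = 0) :
    b = 0 := by
  have h1 := pathRep_lift_barHom K hH hS hb 1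
  rw [h, map_zero, LinearMap.zero_apply, mul_one] at h1
  have h2 : ∀ x, vert K (barR r s H S hH) (barS r s H S) x * b = 0 := by
    intro x
    refine (LeavittFamily.univ K (barR r s H S hH) (barS r s H S)).P_eq_zero_of_barCoeff ?_
    rw [← LeavittFamily.pathCoeff_of_eq _ hS (p := (barPath r s H S x).1)
      (u := (barPath r s H S x).2) rfl]
    exact (congrFun (congrFun h1 _) _).symm
  obtain ⟨F, hF⟩ := exists_vert_sum_mul K _ _ hb
  rw [← hF F subset_rfl, Finset.sum_mul, Finset.sum_eq_zero fun x _ => h2 x]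

end Homomorphism
section Range

namespace LeavittFamily

variable {r s : E → V} {H S : Set V} {A : Type*} [Ring A] [Algebra K A]
  (F : LeavittFamily r s A)

/-- The subalgebra generated by the Leavitt family of `Ē_{(H,S)}`. -/
noncomputable def barAlgebra (H S : Set V) : NonUnitalSubalgebra K A :=
  NonUnitalAlgebra.adjoin K
    (Set.range (F.barP H S) ∪ Set.range (F.barT H S) ∪ Set.range (F.barU H S))

theorem barP_mem (x : BarV r s H S) : F.barP H S x ∈ F.barAlgebra K H S :=
  NonUnitalAlgebra.subset_adjoin K (.inl (.inl ⟨x, rfl⟩))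

theorem barT_mem (e : BarE r s H S) : F.barT H S e ∈ F.barAlgebra K H S :=
  NonUnitalAlgebra.subset_adjoin K (.inl (.inr ⟨e, rfl⟩))

theorem barU_mem (e : BarE r s H S) : F.barU H S e ∈ F.barAlgebra K H S :=
  NonUnitalAlgebra.subset_adjoin K (.inr ⟨e, rfl⟩)

theorem T_mem {e : E} (hs : s e ∈ H ∪ S) (hr : r e ∈ H) : F.T e ∈ F.barAlgebra K H S := by
  obtain ⟨b, rfl⟩ := exists_barEdge hs hr
  exact F.barT_mem K (.inl b)

theorem U_mem {e : E} (hs : s e ∈ H ∪ S) (hr : r e ∈ H) : F.U e ∈ F.barAlgebra K H S := by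
  obtain ⟨b, rfl⟩ := exists_barEdge hs hr
  exact F.barU_mem K (.inl b)

variable (hH : Hereditary r s H) (hS : S ⊆ breakingVertices r s H)

include hH hS

theorem gap_mem {u : V} (h : u ∈ H ∪ S) : F.gap H u ∈ F.barAlgebra K H S := by
  obtain ⟨x, hx⟩ := exists_barPath_inl (r := r) (s := s) h
  rw [← F.barP_of_nil hH hS hx]
  exact F.barP_mem K _

theorem mon_mem {p : List E} {u : V} (h : ValidPath r s H (H ∪ S) p u) :
    F.mon H p u ∈ F.barAlgebra K H S := by
  cases p with
  | nil => exact F.gap_mem K hH hS h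
  | cons e q =>
    obtain ⟨x, hx⟩ := exists_barPath_inr (List.cons_ne_nil e q) h
    have := F.barT_mem K (.inr x)
    rwa [barT, hx] at this

theorem monStar_mem {p : List E} {u : V} (h : ValidPath r s H (H ∪ S) p u) :
    F.monStar H p u ∈ F.barAlgebra K H S := by
  cases p with
  | nil => exact F.gap_mem K hH hS h
  | cons e q =>
    obtain ⟨x, hx⟩ := exists_barPath_inr (List.cons_ne_nil e q) h
    have := F.barU_mem K (.inr x)
    rwa [barU, hx] at this

theorem P_mul_mon_mem (v : V) {p : List E} {u : V} (h : ValidPath r s H (H ∪ S) p u) :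
    F.P v * F.mon H p u ∈ F.barAlgebra K H S := by
  by_cases hv : v = pathSrc s p u
  · rw [hv, P_mul_mon]
    exact F.mon_mem K hH hS h
  · rw [F.P_mul_mon_of_ne hv]
    exact zero_mem _

theorem monStar_mul_P_mem (v : V) {p : List E} {u : V} (h : ValidPath r s H (H ∪ S) p u) :
    F.monStar H p u * F.P v ∈ F.barAlgebra K H S := by
  by_cases hv : v = pathSrc s p u
  · rw [hv, monStar_mul_P]
    exact F.monStar_mem K hH hS h
  · rw [F.monStar_mul_P_of_ne hv]
    exact zero_mem _

theorem T_mul_mon_mem (e : E) {p : List E} {u : V} (h : ValidPath r s H (H ∪ S) p u) :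
    F.T e * F.mon H p u ∈ F.barAlgebra K H S := by
  by_cases he : r e = pathSrc s p u
  · by_cases hp : p = [] → u ∈ H → s e ∉ H ∪ S
    · exact F.mon_mem K hH hS (p := e :: p) ⟨he, h, hp⟩
    · push Not at hp
      obtain ⟨rfl, hu, hs⟩ := hp
      obtain rfl : r e = u := he
      rw [mon, F.gap_eq_P hH hu, F.mulRng]
      exact F.T_mem K hs hu
  · rw [← F.mulRng, mul_assoc, F.P_mul_mon_of_ne he, mul_zero]
    exact zero_mem _

theorem monStar_mul_U_mem (e : E) {p : List E} {u : V} (h : ValidPath r s H (H ∪ S) p u) :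
    F.monStar H p u * F.U e ∈ F.barAlgebra K H S := by
  by_cases he : r e = pathSrc s p u
  · by_cases hp : p = [] → u ∈ H → s e ∉ H ∪ S
    · exact F.monStar_mem K hH hS (p := e :: p) ⟨he, h, hp⟩
    · push Not at hp
      obtain ⟨rfl, hu, hs⟩ := hp
      obtain rfl : r e = u := he
      rw [monStar, F.gap_eq_P hH hu, F.rngMulStar]
      exact F.U_mem K hs hu
  · rw [← F.rngMulStar, ← mul_assoc, F.monStar_mul_P_of_ne he, zero_mul]
    exact zero_mem _

theorem U_mul_mon_mem (e : E) {p : List E} {u : V} (h : ValidPath r s H (H ∪ S) p u) :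
    F.U e * F.mon H p u ∈ F.barAlgebra K H S := by
  cases p with
  | nil =>
    rw [mon]
    by_cases he : s e = u
    · subst he
      by_cases hr : r e ∈ H
      · rw [F.U_mul_gap hr]
        exact F.U_mem K h hr
      · rw [F.U_mul_gap_of_notMem (finite_out_notMem hH hS _ h) hr]
        exact zero_mem _
    · rw [F.U_mul_gap_of_ne he]
      exact zero_mem _
  | cons f q =>
    rw [mon, ← mul_assoc]
    by_cases hef : e = f
    · rw [hef, F.ck1]
      exact F.P_mul_mon_mem K hH hS _ h.2.1
    · rw [F.ck1Orth hef, zero_mul]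
      exact zero_mem _

theorem monStar_mul_T_mem (e : E) {p : List E} {u : V} (h : ValidPath r s H (H ∪ S) p u) :
    F.monStar H p u * F.T e ∈ F.barAlgebra K H S := by
  cases p with
  | nil =>
    rw [monStar]
    by_cases he : s e = u
    · subst he
      by_cases hr : r e ∈ H
      · rw [F.gap_mul_T hr]
        exact F.T_mem K h hr
      · rw [F.gap_mul_T_of_notMem (finite_out_notMem hH hS _ h) hr]
        exact zero_mem _
    · rw [F.gap_mul_T_of_ne he]
      exact zero_mem _
  | cons f q =>
    rw [monStar, mul_assoc]
    by_cases hef : f = e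
    · rw [hef, F.ck1]
      exact F.monStar_mul_P_mem K hH hS _ h.2.1
    · rw [F.ck1Orth hef, mul_zero]
      exact zero_mem _

theorem mul_mem_barAlgebra {x : A}
    (hx : ∀ {p u}, ValidPath r s H (H ∪ S) p u → x * F.mon H p u ∈ F.barAlgebra K H S)
    {a : A} (ha : a ∈ F.barAlgebra K H S) : x * a ∈ F.barAlgebra K H S := by
  have hf := finite_out_notMem hH hS
  have key : ∀ {p u b}, ValidPath r s H (H ∪ S) p u → b ∈ F.barAlgebra K H S →
      F.mon H p u * b = b → x * b ∈ F.barAlgebra K H S := by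
    intro p u b h hb he
    rw [← he, ← mul_assoc]
    exact mul_mem (hx h) hb
  induction ha using NonUnitalAlgebra.adjoin_induction with
  | mem a ha =>
    obtain (⟨y, rfl⟩ | ⟨e, rfl⟩) | ⟨e, rfl⟩ := ha
    · have h := validPath_barPath y hH hS
      rw [barP, ← mul_assoc]
      exact mul_mem (hx h) (F.monStar_mem K hH hS h)
    · rcases e with b | y
      · exact key (p := []) (s_barEdge_mem b) (F.barT_mem K _) (F.gap_mul_T (r_barEdge_mem hH b))
      · exact hx (validPath_barPath (.inr y) hH hS)
    · rcases e with b | y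
      · have hr := r_barEdge_mem hH b
        refine key (p := []) (.inl hr) (F.barU_mem K _) ?_
        rw [mon, F.gap_eq_P hH hr]
        exact F.rngMulStar _
      · have h := (validPath_barPath (.inr y) hH hS).mem
        exact key (p := []) h (F.barU_mem K _) (F.gap_mul_monStar hf h)
  | add a b _ _ ha hb => rw [mul_add]; exact add_mem ha hb
  | zero => rw [mul_zero]; exact zero_mem _
  | mul a b _ hb ha _ => rw [← mul_assoc]; exact mul_mem ha hb
  | smul k a _ ha => rw [mul_smul_comm]; exact SMulMemClass.smul_mem k ha

theorem mem_barAlgebra_mul {x : A}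
    (hx : ∀ {p u}, ValidPath r s H (H ∪ S) p u → F.monStar H p u * x ∈ F.barAlgebra K H S)
    {a : A} (ha : a ∈ F.barAlgebra K H S) : a * x ∈ F.barAlgebra K H S := by
  have hf := finite_out_notMem hH hS
  have key : ∀ {p u b}, ValidPath r s H (H ∪ S) p u → b ∈ F.barAlgebra K H S →
      b * F.monStar H p u = b → b * x ∈ F.barAlgebra K H S := by
    intro p u b h hb he
    rw [← he, mul_assoc]
    exact mul_mem hb (hx h)
  induction ha using NonUnitalAlgebra.adjoin_induction with
  | mem a ha =>
    obtain (⟨y, rfl⟩ | ⟨e, rfl⟩) | ⟨e, rfl⟩ := ha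
    · have h := validPath_barPath y hH hS
      rw [barP, mul_assoc]
      exact mul_mem (F.mon_mem K hH hS h) (hx h)
    · rcases e with b | y
      · have hr := r_barEdge_mem hH b
        refine key (p := []) (.inl hr) (F.barT_mem K _) ?_
        rw [monStar, F.gap_eq_P hH hr]
        exact F.mulRng _
      · have h := (validPath_barPath (.inr y) hH hS).mem
        exact key (p := []) h (F.barT_mem K _) (F.mon_mul_gap hf h)
    · rcases e with b | y
      · exact key (p := []) (s_barEdge_mem b) (F.barU_mem K _) (F.U_mul_gap (r_barEdge_mem hH b))
      · exact hx (validPath_barPath (.inr y) hH hS)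
  | add a b _ _ ha hb => rw [add_mul]; exact add_mem ha hb
  | zero => rw [zero_mul]; exact zero_mem _
  | mul a b ha _ _ hb => rw [mul_assoc]; exact mul_mem ha hb
  | smul k a _ ha => rw [smul_mul_assoc]; exact SMulMemClass.smul_mem k ha

end LeavittFamily

variable {r s : E → V} {H S : Set V} (hH : Hereditary r s H) (hS : S ⊆ breakingVertices r s H)

include hH hS

open LeavittFamily

theorem univ_mul_mem_barAlgebra (x : LPA K r s) : ∀ {a : LPA K r s},
    a ∈ (univ K r s).barAlgebra K H S → x * a ∈ (univ K r s).barAlgebra K H S := by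
  induction x using lpa_induction with
  | algebraMap k => intro a ha; rw [← Algebra.smul_def]; exact SMulMemClass.smul_mem k ha
  | vert v => exact mul_mem_barAlgebra K _ hH hS (P_mul_mon_mem K (univ K r s) hH hS v)
  | edge e => exact mul_mem_barAlgebra K _ hH hS (T_mul_mon_mem K (univ K r s) hH hS e)
  | ghost e => exact mul_mem_barAlgebra K _ hH hS (U_mul_mon_mem K (univ K r s) hH hS e)
  | mul x y hx hy => intro a ha; rw [mul_assoc]; exact hx (hy ha)
  | add x y hx hy => intro a ha; rw [add_mul]; exact add_mem (hx ha) (hy ha)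

theorem mem_barAlgebra_mul_univ (x : LPA K r s) : ∀ {a : LPA K r s},
    a ∈ (univ K r s).barAlgebra K H S → a * x ∈ (univ K r s).barAlgebra K H S := by
  induction x using lpa_induction with
  | algebraMap k =>
    intro a ha
    rw [← Algebra.commutes, ← Algebra.smul_def]
    exact SMulMemClass.smul_mem k ha
  | vert v => exact mem_barAlgebra_mul K _ hH hS (monStar_mul_P_mem K (univ K r s) hH hS v)
  | edge e => exact mem_barAlgebra_mul K _ hH hS (monStar_mul_T_mem K (univ K r s) hH hS e)
  | ghost e => exact mem_barAlgebra_mul K _ hH hS (monStar_mul_U_mem K (univ K r s) hH hS e)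
  | mul x y hx hy => intro a ha; rw [← mul_assoc]; exact hy (hx ha)
  | add x y hx hy => intro a ha; rw [mul_add]; exact add_mem (hx ha) (hy ha)

omit hH in
theorem gapL_eq_gap {v : V} (hv : v ∈ S) :
    gapL K r s H v (hS hv).2.1 = (univ K r s).gap H v := by
  rw [gapL, gap]
  congr 1
  refine Finset.sum_congr ?_ fun _ _ => rfl
  ext e
  rw [mem_outEdges (hS hv).2.1, Set.Finite.mem_toFinset, Set.mem_ofPred_eq]

theorem span_subset_barAlgebra :
    (TwoSidedIdeal.span (idealGens K r s H S hS) : Set (LPA K r s)) ⊆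
      (univ K r s).barAlgebra K H S := by
  have hle : TwoSidedIdeal.span (idealGens K r s H S hS) ≤
      .mk' ((univ K r s).barAlgebra K H S) (zero_mem _) add_mem neg_mem
        (univ_mul_mem_barAlgebra K hH hS _) (mem_barAlgebra_mul_univ K hH hS _) := by
    rw [TwoSidedIdeal.span_le]
    rintro _ (⟨v, hv, rfl⟩ | ⟨v, hv, rfl⟩)
    · rw [SetLike.mem_coe, TwoSidedIdeal.mem_mk']
      have := (univ K r s).gap_mem K hH hS (Or.inl hv)
      rwa [gap_eq_P _ hH hv] at this
    · rw [SetLike.mem_coe, TwoSidedIdeal.mem_mk', gapL_eq_gap K hS hv]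
      exact (univ K r s).gap_mem K hH hS (Or.inr hv)
  exact fun x hx => (TwoSidedIdeal.mem_mk' ..).1 (hle hx)

theorem barAlgebra_subset_span :
    ((univ K r s).barAlgebra K H S : Set (LPA K r s)) ⊆
      (TwoSidedIdeal.span (idealGens K r s H S hS) : Set (LPA K r s)) := by
  set I := TwoSidedIdeal.span (idealGens K r s H S hS)
  have hf := finite_out_notMem hH hS
  have hgap : ∀ {u}, u ∈ H ∪ S → (univ K r s).gap H u ∈ I := by
    rintro u (hu | hu)
    · rw [gap_eq_P _ hH hu]
      exact TwoSidedIdeal.subset_span (.inl ⟨u, hu, rfl⟩)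
    · exact TwoSidedIdeal.subset_span (.inr ⟨u, hu, (gapL_eq_gap K hS hu).symm⟩)
  have hmon : ∀ x : BarV r s H S,
      (univ K r s).mon H (barPath r s H S x).1 (barPath r s H S x).2 ∈ I := by
    intro x
    have h := (validPath_barPath x hH hS).mem
    rw [← mon_mul_gap _ hf h]
    exact I.mul_mem_left _ _ (hgap h)
  have hstar : ∀ x : BarV r s H S,
      (univ K r s).monStar H (barPath r s H S x).1 (barPath r s H S x).2 ∈ I := by
    intro x
    have h := (validPath_barPath x hH hS).mem
    rw [← gap_mul_monStar _ hf h]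
    exact I.mul_mem_right _ _ (hgap h)
  intro a (ha : a ∈ (univ K r s).barAlgebra K H S)
  change a ∈ I
  induction ha using NonUnitalAlgebra.adjoin_induction with
  | mem a ha =>
    obtain (⟨y, rfl⟩ | ⟨b | y, rfl⟩) | ⟨b | y, rfl⟩ := ha
    · exact I.mul_mem_left _ _ (hstar y)
    · rw [barT, ← gap_mul_T _ (r_barEdge_mem hH b)]
      exact I.mul_mem_right _ _ (hgap (s_barEdge_mem b))
    · exact hmon (.inr y)
    · rw [barU, ← U_mul_gap _ (r_barEdge_mem hH b)]
      exact I.mul_mem_left _ _ (hgap (s_barEdge_mem b))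
    · exact hstar (.inr y)
  | add a b _ _ ha hb => exact I.add_mem ha hb
  | zero => exact I.zero_mem
  | mul a b _ _ ha _ => exact I.mul_mem_right _ _ ha
  | smul k a _ ha =>
    rw [Algebra.smul_def]
    exact I.mul_mem_left _ _ ha

theorem map_barHom : (LPAproper K (barR r s H S hH) (barS r s H S)).map (barHom K hH hS) =
    (univ K r s).barAlgebra K H S := by
  rw [LPAproper, NonUnitalAlgHom.map_adjoin, barAlgebra]
  congr 1
  rw [Set.image_union, Set.image_union, ← Set.range_comp, ← Set.range_comp, ← Set.range_comp]
  congr! 3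
  · ext x; exact lift_vert _ x
  · ext x; exact lift_edge _ x
  · ext x; exact lift_ghost _ x

end Range

set_option synthInstance.maxHeartbeats 1000000 in
set_option maxHeartbeats 1000000 in
/-- For `H` saturated hereditary and `S ⊆ B_H`, there is an
injective `K`-algebra homomorphism `φ : L_K(Ē_{(H,S)}) → L_K(E)` whose image is
exactly the ideal `I_{(H,S)}`; consequently `I_{(H,S)}`, as a (not necessarily
unital) `K`-algebra, is isomorphic to the Leavitt path algebra `L_K(Ē_{(H,S)})`. -/
theorem ideal_iso_leavitt_bar
    (r s : E → V) (H S : Set V) (hH : Hereditary r s H) (hSat : Saturated r s H)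
    (hS : S ⊆ breakingVertices r s H) :
    ∃ φ : ↥(LPAproper K (barR r s H S hH) (barS r s H S)) →ₙₐ[K] LPA K r s,
      Function.Injective ⇑φ ∧
      Set.range ⇑φ = (TwoSidedIdeal.span (idealGens K r s H S hS) : Set (LPA K r s)) := by
  refine ⟨((barHom K hH hS : _ →ₙₐ[K] LPA K r s)).comp
    (NonUnitalSubalgebraClass.subtype (LPAproper K (barR r s H S hH) (barS r s H S))), ?_, ?_⟩
  · rw [injective_iff_map_eq_zero]
    exact fun b hb => Subtype.ext (eq_zero_of_barHom_eq_zero K hH hS b.2 hb)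
  · rw [(span_subset_barAlgebra K hH hS).antisymm (barAlgebra_subset_span K hH hS),
      ← map_barHom K hH hS]
    ext a
    constructor
    · rintro ⟨b, rfl⟩
      exact ⟨b.1, b.2, rfl⟩
    · rintro ⟨b, hb, rfl⟩
      exact ⟨⟨b, hb⟩, rfl⟩

end Bar

end GraphIdeals
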